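/- arXiv:1902.05250 — 7 statements merged into one kernel-verified Lean document; each statement's English description precedes it below -/
import Mathlib

section
/- Let n be a positive integer such that d = n^2 + 1 is squarefree and d ≡ 1 (mod 8). If the number N of distinct odd prime divisors of n satisfies N ≥ 3, then the class number of the real quadratic field Q(√d) is at least N + 2. -/
lemma descent (n : ℤ) (hn : 4 ≤ n) (m : ℤ) (hm2 : 2 * m < n) :
    ∀ (k : ℕ) (a b : ℤ), b.natAbs = k → |a ^ 2 - (n ^ 2 + 1) * b ^ 2| = 4 * m →
      ∃ c : ℤ, m = c * c := by
  intro k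
  induction k using Nat.strong_induction_on with
  | _ k ih =>
  intro a b hb hab
  wlog ha : 0 ≤ a generalizing a
  · exact this (-a) (by rw [neg_sq]; exact hab) (by omega)
  wlog hb0 : 0 ≤ b generalizing b
  · exact this (-b) (by omega) (by rw [neg_sq]; exact hab) (by omega)
  have hbd := abs_le.1 hab.le
  rcases hb0.eq_or_lt with h0 | h0
  · subst h0
    have h1 : a ^ 2 = 4 * m := by
      rw [← hab, abs_of_nonneg] <;> nlinarith [sq_nonneg a]
    have : (2 : ℤ) ∣ a := by
      have : (2 : ℤ) ∣ a ^ 2 := ⟨2 * m, by linarith⟩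
      exact Int.prime_two.dvd_of_dvd_pow this
    obtain ⟨c, rfl⟩ := this
    exact ⟨c, by nlinarith⟩
  rcases (show 1 ≤ b by omega).eq_or_lt with h1 | h1
  · exfalso
    subst h1
    obtain ⟨h2, h3⟩ := hbd
    have h4 : a ≤ n + 1 := by by_contra h; nlinarith
    have h5 : n - 1 ≤ a := by by_contra h; nlinarith
    obtain h | h | h : a = n - 1 ∨ a = n ∨ a = n + 1 := by omega
    all_goals subst h
    · have := neg_le_abs ((n-1) ^ 2 - (n ^ 2 + 1) * 1 ^ 2)
      nlinarith
    · ring_nf at hab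
      norm_num at hab
      omega
    · have := le_abs_self ((n+1) ^ 2 - (n ^ 2 + 1) * 1 ^ 2)
      nlinarith
  · have hx : |a - n * b| < b := by
      rw [abs_lt]
      constructor
      · by_contra h
        have h6 : a ≤ (n - 1) * b := by linarith
        have h7 : a ^ 2 ≤ ((n - 1) * b) ^ 2 := by gcongr
        nlinarith [mul_nonneg (show 0 ≤ n by omega) (show 0 ≤ b ^ 2 - 1 by nlinarith)]
      · by_contra h
        have h6 : (n + 1) * b ≤ a := by linarith
        have h7 : ((n + 1) * b) ^ 2 ≤ a ^ 2 := by gcongr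
        nlinarith [mul_nonneg (show 0 ≤ n by omega) (show 0 ≤ b ^ 2 - 1 by nlinarith)]
    refine ih (a - n * b).natAbs (by rw [Int.abs_eq_natAbs] at hx; omega) ((n ^ 2 + 1) * b - n * a) (a - n * b) rfl ?_
    rw [← hab, ← abs_neg]
    congr 1
    ring


open NumberField

lemma trace_norm (d : ℕ) (hd : ¬ IsSquare d)
    (K : Type) [Field K] [NumberField K]
    (hdeg : Module.finrank ℚ K = 2) (α : K) (hα : α ^ 2 = (d : K)) :
    (∀ r s : ℚ, Algebra.trace ℚ K (algebraMap ℚ K r + algebraMap ℚ K s * α) = 2 * r) ∧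
    (∀ r s : ℚ, Algebra.norm ℚ (algebraMap ℚ K r + algebraMap ℚ K s * α) = r ^ 2 - d * s ^ 2) ∧
    (∀ x : K, ∃ r s : ℚ, x = algebraMap ℚ K r + algebraMap ℚ K s * α) := by
  have hli : LinearIndependent ℚ ![(1 : K), α] := by
    rw [LinearIndependent.pair_iff' one_ne_zero]
    intro a ha
    apply hd
    rw [Algebra.smul_def, mul_one] at ha
    have h1 : a ^ 2 = d := by
      apply (algebraMap ℚ K).injective
      rw [map_pow, ha, hα, map_natCast]
    rw [← Rat.isSquare_natCast_iff]
    exact ⟨a, by rw [← h1, sq]⟩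
  let b := basisOfLinearIndependentOfCardEqFinrank hli (by simp [hdeg])
  have hb : ⇑b = ![(1 : K), α] := coe_basisOfLinearIndependentOfCardEqFinrank _ _
  have hb0 : b 0 = 1 := by rw [hb]; rfl
  have hb1 : b 1 = α := by rw [hb]; rfl
  have hex : ∀ x : K, ∃ r s : ℚ, x = algebraMap ℚ K r + algebraMap ℚ K s * α := by
    intro x
    refine ⟨b.repr x 0, b.repr x 1, ?_⟩
    have := b.sum_repr x
    rw [Fin.sum_univ_two, hb0, hb1, Algebra.smul_def, Algebra.smul_def, mul_one] at this
    exact this.symm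
  have hrep : ∀ r s : ℚ, ⇑(b.repr (algebraMap ℚ K r + algebraMap ℚ K s * α)) = ![r, s] := by
    intro r s
    have : algebraMap ℚ K r + algebraMap ℚ K s * α = r • b 0 + s • b 1 := by
      rw [hb0, hb1, Algebra.smul_def, Algebra.smul_def, mul_one]
    rw [this]
    ext i
    fin_cases i <;> simp
  have hmat : ∀ r s : ℚ, Algebra.leftMulMatrix b (algebraMap ℚ K r + algebraMap ℚ K s * α)
      = !![r, d * s; s, r] := by
    intro r s
    have e1 : (algebraMap ℚ K r + algebraMap ℚ K s * α) * α =
      algebraMap ℚ K (d * s) + algebraMap ℚ K r * α := by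
      rw [map_mul, map_natCast, ← hα]; ring
    ext i j
    rw [Algebra.leftMulMatrix_eq_repr_mul]
    fin_cases j
    · change b.repr (_ * b 0) i = _
      rw [hb0, mul_one, hrep]
      fin_cases i <;> rfl
    · change b.repr (_ * b 1) i = _
      rw [hb1, e1, hrep]
      fin_cases i <;> rfl
  refine ⟨fun r s => ?_, fun r s => ?_, hex⟩
  · rw [Algebra.trace_eq_matrix_trace b, hmat, Matrix.trace_fin_two]
    simp; ring
  · rw [Algebra.norm_eq_matrix_det b, hmat, Matrix.det_fin_two]
    simp; ring

lemma norm_form (d : ℕ) (hd : ¬ IsSquare d) (hsf : Squarefree d)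
    (K : Type) [Field K] [NumberField K]
    (hdeg : Module.finrank ℚ K = 2) (α : K) (hα : α ^ 2 = (d : K)) (x : 𝓞 K) :
    ∃ a b : ℤ, 4 * Algebra.norm ℤ x = a ^ 2 - d * b ^ 2 := by
  obtain ⟨htr, hnm, hex⟩ := trace_norm d hd K hdeg α hα
  have hint : IsIntegral ℤ α := by
    apply IsIntegral.of_pow (n := 2) (by norm_num)
    rw [hα]
    exact_mod_cast isIntegral_algebraMap (R := ℤ) (A := K) (x := (d : ℤ))
  let A : 𝓞 K := ⟨α, hint⟩
  obtain ⟨r, s, hx⟩ := hex (x : K)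
  have h1 : ((Algebra.trace ℤ (𝓞 K) x : ℤ) : ℚ) = 2 * r := by
    rw [Algebra.coe_trace_int, hx, htr]
  have h2 : ((Algebra.norm ℤ x : ℤ) : ℚ) = r ^ 2 - d * s ^ 2 := by
    rw [Algebra.coe_norm_int, hx, hnm]
  have h3 : ((Algebra.trace ℤ (𝓞 K) (x * A) : ℤ) : ℚ) = 2 * (d * s) := by
    rw [Algebra.coe_trace_int, ← htr (d * s) r]
    congr 1
    change (x : K) * α = _
    rw [hx, map_mul, map_natCast, ← hα]; ring
  generalize Algebra.trace ℤ (𝓞 K) (x * A) = c at h3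
  generalize Algebra.trace ℤ (𝓞 K) x = a at h1
  generalize Algebra.norm ℤ x = N at h2
  have h4 : c ^ 2 = d * (a ^ 2 - 4 * N) := by
    have : (c : ℚ) ^ 2 = d * (a ^ 2 - 4 * N) := by rw [h1, h2, h3]; ring
    exact_mod_cast this
  have h5 : (d : ℤ) ∣ c :=
    ((Int.squarefree_natCast.2 hsf).dvd_pow_iff_dvd two_ne_zero).1 ⟨_, h4⟩
  obtain ⟨b, rfl⟩ := h5
  have hd0 : (d : ℤ) ≠ 0 := by exact_mod_cast hsf.ne_zero
  refine ⟨a, b, ?_⟩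
  have : (d : ℤ) * (d * b ^ 2) = d * (a ^ 2 - 4 * N) := by rw [← h4]; ring
  have := mul_left_cancel₀ hd0 this
  linarith

lemma ideals (K : Type) [Field K] [NumberField K] (hdeg : Module.finrank ℚ K = 2)
    (w : 𝓞 K) (k : ℕ) (hw : w * (w - 1) = (k : 𝓞 K) ^ 2)
    (htr : Algebra.trace ℤ (𝓞 K) w = 1) (q : ℕ) (hq : q.Prime ∨ q = 1) (hqk : q ∣ k) :
    ∃ I J : Ideal (𝓞 K), I * J = Ideal.span {(q : 𝓞 K)} ∧
      Ideal.absNorm I = q ∧ Ideal.absNorm J = q := by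
  rcases hq with hq | rfl
  swap
  · exact ⟨⊤, ⊤, by simp, by simp, by simp⟩
  have hrk : Module.finrank ℤ (𝓞 K) = 2 := by rw [RingOfIntegers.rank, hdeg]
  have hkey : ∀ u v : 𝓞 K, u * v = (k : 𝓞 K) ^ 2 → ¬ (q : ℤ) ∣ Algebra.trace ℤ (𝓞 K) v →
      Ideal.span {(q : 𝓞 K), u} ≠ ⊤ := by
    intro u v huv hv h
    apply hv
    rw [Ideal.eq_top_iff_one, Ideal.mem_span_pair] at h
    obtain ⟨x, y, hxy⟩ := h
    obtain ⟨l, rfl⟩ := hqk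
    have : v = (q : ℤ) • (x * v + y * (q * l ^ 2)) := by
      rw [zsmul_eq_mul]
      push_cast at huv ⊢
      linear_combination (-v) * hxy + y * huv
    rw [this, map_smul, smul_eq_mul]
    exact dvd_mul_right _ _
  have htr1 : Algebra.trace ℤ (𝓞 K) (w - 1) = -1 := by
    have : Algebra.trace ℤ (𝓞 K) 1 = 2 := by
      have := Algebra.trace_algebraMap (S := 𝓞 K) (1 : ℤ)
      rw [map_one, hrk] at this
      simpa using this
    rw [map_sub, htr, this]; norm_num
  have hq1 : ¬ (q : ℤ) ∣ 1 := by
    intro h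
    exact hq.one_lt.ne' (by exact_mod_cast Int.eq_one_of_dvd_one (by positivity) h)
  have hI := hkey w (w - 1) hw (by rwa [htr1, Int.dvd_neg])
  have hJ := hkey (w - 1) w (by rw [mul_comm, hw]) (by rwa [htr])
  have hprod : Ideal.span {(q : 𝓞 K), w} * Ideal.span {(q : 𝓞 K), w - 1} =
      Ideal.span {(q : 𝓞 K)} := by
    rw [Ideal.span_pair_mul_span_pair]
    apply le_antisymm
    · rw [Ideal.span_le]
      obtain ⟨l, rfl⟩ := hqk
      rintro z (rfl | rfl | rfl | rfl)
      all_goals rw [SetLike.mem_coe, Ideal.mem_span_singleton]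
      · exact dvd_mul_right _ _
      · exact dvd_mul_right _ _
      · exact dvd_mul_left _ _
      · rw [hw]
        exact ⟨q * l ^ 2, by push_cast; ring⟩
    · rw [Ideal.span_singleton_le_iff_mem]
      have h1 : (q : 𝓞 K) * (w - 1) ∈ Ideal.span
        {(q : 𝓞 K) * q, (q : 𝓞 K) * (w - 1), w * q, w * (w - 1)} := Ideal.subset_span (by simp)
      have h2 : w * q ∈ Ideal.span
        {(q : 𝓞 K) * q, (q : 𝓞 K) * (w - 1), w * q, w * (w - 1)} := Ideal.subset_span (by simp)
      have := sub_mem h2 h1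
      convert this using 1
      ring
  have hn := congrArg Ideal.absNorm hprod
  have hqn : (Algebra.norm ℤ (q : 𝓞 K)).natAbs = q ^ 2 := by
    have := Algebra.norm_algebraMap (S := 𝓞 K) (q : ℤ)
    rw [hrk, map_natCast] at this
    rw [this, Int.natAbs_pow, Int.natAbs_natCast]
  rw [map_mul, Ideal.absNorm_span_singleton, hqn] at hn
  rw [ne_eq, ← Ideal.absNorm_eq_one_iff] at hI hJ
  refine ⟨_, _, hprod, ?_⟩
  exact (Nat.Prime.mul_eq_prime_sq_iff hq hI hJ).1 hn

lemma bound (n j : ℕ) (hnj : n = 4 * j) (hn : 0 < n) (S : Finset ℕ)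
    (hS : ∀ p ∈ S, p.Prime ∧ p ≠ 2 ∧ p ∣ n) (hN : 3 ≤ S.card) :
    ∀ p ∈ insert 1 (insert 2 S), ∀ q ∈ insert 1 (insert 2 S), p ≠ q → 2 * (p * q) < n := by
  have hSj : ∀ p ∈ S, p ∣ j := by
    intro p hp
    obtain ⟨h1, h2, h3⟩ := hS p hp
    rw [hnj] at h3
    refine Nat.Coprime.dvd_of_dvd_mul_left ?_ h3
    have : Nat.Coprime p (2 ^ 2) := Nat.Coprime.pow_right 2 ((Nat.coprime_primes h1 Nat.prime_two).2 h2)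
    simpa using this
  have hj : 0 < j := by omega
  have hpq : ∀ p ∈ S, ∀ q ∈ S, p ≠ q → p * q ≤ j := by
    intro p hp q hq hne
    exact Nat.le_of_dvd hj (Nat.Prime.dvd_mul_of_dvd_ne hne (hS p hp).1 (hS q hq).1 (hSj p hp) (hSj q hq))
  have h3 : ∀ p ∈ S, 3 ≤ p := by
    intro p hp
    have := (hS p hp).1.two_le
    have := (hS p hp).2.1
    omega
  have hs : ∀ p ∈ S, 3 * p ≤ j := by
    intro p hp
    obtain ⟨r, hr, hne⟩ := Finset.exists_mem_ne (by omega : 1 < S.card) p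
    have := hpq r hr p hp hne
    have := Nat.mul_le_mul_right p (h3 r hr)
    omega
  obtain ⟨r, hr⟩ := Finset.card_pos.1 (by omega : 0 < S.card)
  have hr1 := hs r hr
  have hr3 := h3 r hr
  intro p hp q hq hne
  simp only [Finset.mem_insert] at hp hq
  rcases hp with rfl | rfl | hp <;> rcases hq with rfl | rfl | hq
  · omega
  · omega
  · have := hs q hq; omega
  · omega
  · omega
  · have := hs q hq; have := h3 q hq; omega
  · have := hs p hp; have := h3 p hp; omega
  · have := hs p hp; have := h3 p hp; omega
  · have := hpq p hp q hq hne; omega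

/-- If `d = n^2 + 1` is squarefree with `d ≡ 1 (mod 8)` and `n` has at least
`N ≥ 3` distinct odd prime divisors, then the class number of `ℚ(√d)`
(formalized as any number field of degree 2 over `ℚ` containing a square root
of `d`) is at least `N + 2`. -/
theorem class_number_lower_bound_one_mod_eight
    (n : ℕ) (hn : 0 < n) (d : ℕ) (hd : d = n ^ 2 + 1)
    (hsf : Squarefree d) (hmod : d % 8 = 1)
    (hN : 3 ≤ (n.primeFactors.filter fun p => p ≠ 2).card)
    (K : Type) [Field K] [NumberField K]
    (hdeg : Module.finrank ℚ K = 2) (α : K) (hα : α ^ 2 = (d : K)) :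
    (n.primeFactors.filter fun p => p ≠ 2).card + 2 ≤ NumberField.classNumber K := by
  classical
  set S := n.primeFactors.filter fun p => p ≠ 2 with hSdef
  have hS : ∀ p ∈ S, p.Prime ∧ p ≠ 2 ∧ p ∣ n := by
    intro p hp
    rw [hSdef, Finset.mem_filter, Nat.mem_primeFactors] at hp
    exact ⟨hp.1.1, hp.2, hp.1.2.1⟩
  have h4 : 4 ∣ n := by
    have h1 : n ^ 2 % 8 = 0 := by omega
    have h2 : n % 8 = 0 ∨ n % 8 = 1 ∨ n % 8 = 2 ∨ n % 8 = 3 ∨ n % 8 = 4 ∨ n % 8 = 5 ∨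
      n % 8 = 6 ∨ n % 8 = 7 := by omega
    rw [Nat.pow_mod] at h1
    rcases h2 with h | h | h | h | h | h | h | h <;> rw [h] at h1 <;> omega
  obtain ⟨j, hnj⟩ := h4
  have hdsq : ¬ IsSquare d := by
    rintro ⟨e, he⟩
    have h1 : n < e := by by_contra h; nlinarith
    nlinarith
  obtain ⟨htr, -, -⟩ := trace_norm d hdsq K hdeg α hα
  have hww : ((1 + α) / 2) ^ 2 - (1 + α) / 2 - ((2 * j : ℕ) : K) ^ 2 = 0 := by
    have : α ^ 2 = 16 * (j : K) ^ 2 + 1 := by rw [hα, hd, hnj]; push_cast; ring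
    push_cast
    linear_combination this / 4
  have hwi : IsIntegral ℤ ((1 + α) / 2) := by
    refine ⟨Polynomial.X ^ 2 - Polynomial.X - Polynomial.C (((2 * j : ℕ) : ℤ) ^ 2), ?_, ?_⟩
    · monicity!
    · rw [Polynomial.eval₂_sub, Polynomial.eval₂_C, Polynomial.eval₂_sub, Polynomial.eval₂_X_pow,
        Polynomial.eval₂_X, map_pow, map_natCast]
      exact hww
  let w : 𝓞 K := ⟨(1 + α) / 2, hwi⟩
  have hw : w * (w - 1) = ((2 * j : ℕ) : 𝓞 K) ^ 2 := by
    apply RingOfIntegers.coe_injective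
    have h1 : algebraMap (𝓞 K) K w = (1 + α) / 2 := rfl
    rw [map_mul, map_sub, map_one, h1, map_pow, map_natCast]
    linear_combination hww
  have hwt : Algebra.trace ℤ (𝓞 K) w = 1 := by
    have h1 : ((Algebra.trace ℤ (𝓞 K) w : ℤ) : ℚ) = 1 := by
      rw [Algebra.coe_trace_int]
      have h2 := htr (1/2) (1/2)
      have h3 : (w : K) = algebraMap ℚ K (1/2) + algebraMap ℚ K (1/2) * α := by
        change (1 + α) / 2 = _
        simp
        ring
      rw [h3, h2]; norm_num
    exact_mod_cast h1
  set T := insert 1 (insert 2 S) with hT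
  have hTp : ∀ q ∈ T, q.Prime ∨ q = 1 := by
    intro q hq
    simp only [hT, Finset.mem_insert] at hq
    rcases hq with rfl | rfl | hq
    · exact Or.inr rfl
    · exact Or.inl Nat.prime_two
    · exact Or.inl (hS q hq).1
  have hTd : ∀ q ∈ T, q ∣ 2 * j := by
    intro q hq
    simp only [hT, Finset.mem_insert] at hq
    rcases hq with rfl | rfl | hq
    · exact one_dvd _
    · exact dvd_mul_right _ _
    · obtain ⟨h1, h2, h3⟩ := hS q hq
      rw [hnj, show 4 * j = 2 * (2 * j) by ring] at h3
      exact Nat.Coprime.dvd_of_dvd_mul_left ((Nat.coprime_primes h1 Nat.prime_two).2 h2) h3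
  have hcard : T.card = S.card + 2 := by
    rw [hT, Finset.card_insert_of_notMem, Finset.card_insert_of_notMem]
    · intro h; exact (hS 2 h).2.1 rfl
    · intro h
      rcases Finset.mem_insert.1 h with h | h
      · omega
      · exact Nat.not_prime_one (hS 1 h).1
  have hbound := bound n j hnj hn S hS hN
  have hex : ∀ q : T, ∃ I J : Ideal (𝓞 K), I * J = Ideal.span {((q : ℕ) : 𝓞 K)} ∧
      Ideal.absNorm I = q ∧ Ideal.absNorm J = q := fun q =>
    ideals K hdeg w (2 * j) hw hwt q (hTp q q.2) (hTd q q.2)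
  choose I J hIJ hI hJ using hex
  have hq0 : ∀ q : T, (q : ℕ) ≠ 0 := by
    intro q h
    rcases hTp q q.2 with h1 | h1
    · exact h1.ne_zero h
    · omega
  have hI0 : ∀ q, I q ∈ nonZeroDivisors (Ideal (𝓞 K)) := by
    intro q
    rw [mem_nonZeroDivisors_iff_ne_zero]
    intro h
    have := hI q
    rw [h] at this
    exact hq0 q (by simpa using this.symm)
  have hJ0 : ∀ q, J q ∈ nonZeroDivisors (Ideal (𝓞 K)) := by
    intro q
    rw [mem_nonZeroDivisors_iff_ne_zero]
    intro h
    have := hJ q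
    rw [h] at this
    exact hq0 q (by simpa using this.symm)
  have hinj : Function.Injective (fun q : T => ClassGroup.mk0 ⟨I q, hI0 q⟩) := by
    intro p q hpq
    by_contra hne
    have hne' : (p : ℕ) ≠ q := fun h => hne (Subtype.ext h)
    simp only at hpq
    have h1 : ClassGroup.mk0 ⟨I q, hI0 q⟩ * ClassGroup.mk0 ⟨J q, hJ0 q⟩ = 1 := by
      rw [← map_mul]
      exact (ClassGroup.mk0_eq_one_iff (mul_mem (hI0 q) (hJ0 q))).2 (by rw [hIJ]; exact ⟨⟨_, rfl⟩⟩)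
    rw [← hpq, ← map_mul] at h1
    have h2 := (ClassGroup.mk0_eq_one_iff (mul_mem (hI0 p) (hJ0 q))).1 h1
    obtain ⟨g, hg⟩ := h2.principal
    have h3 : Ideal.absNorm (I p * J q) = p * q := by rw [map_mul, hI, hJ]
    rw [hg, Ideal.submodule_span_eq, Ideal.absNorm_span_singleton] at h3
    obtain ⟨a, b, hab⟩ := norm_form d hdsq hsf K hdeg α hα g
    have h5 := hbound p p.2 q q.2 hne'
    obtain ⟨c, hc⟩ := descent (n : ℤ) (by omega) ((p * q : ℕ) : ℤ) (by exact_mod_cast h5) _ a b rfl (by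
      have : (d : ℤ) = (n : ℤ) ^ 2 + 1 := by rw [hd]; push_cast; ring
      rw [← this, ← hab, abs_mul, Int.abs_eq_natAbs (Algebra.norm ℤ g), h3]
      norm_num)
    have hc' : (p : ℕ) * q = c.natAbs * c.natAbs := by
      rw [← Int.natAbs_mul, ← hc, Int.natAbs_natCast]
    have hcop : Nat.Coprime p q := by
      rcases hTp p p.2 with h | h
      · rcases hTp q q.2 with h' | h'
        · exact (Nat.coprime_primes h h').2 hne'
        · rw [h']; exact Nat.coprime_one_right _
      · rw [h]; exact Nat.coprime_one_left _
    have hsqf : ∀ r : T, Squarefree (r : ℕ) := by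
      intro r
      rcases hTp r r.2 with h | h
      · exact h.prime.squarefree
      · rw [h]; exact squarefree_one
    have h6 : Squarefree ((p : ℕ) * q) := (Nat.squarefree_mul hcop).2 ⟨hsqf p, hsqf q⟩
    have h7 := Nat.isUnit_iff.1 (h6 c.natAbs (by rw [hc']))
    rw [h7, mul_one] at hc'
    have h8 := Nat.eq_one_of_mul_eq_one_right hc'
    have h9 := Nat.eq_one_of_mul_eq_one_left hc'
    exact hne' (by rw [h8, h9])
  have := Fintype.card_le_of_injective _ hinj
  rw [Fintype.card_coe, hcard] at this
  exact this
end

section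
/- Let n be a positive integer such that d = n^2 + 1 is squarefree and d ≡ 2 (mod 4) (equivalently d ≡ 2 or 6 (mod 8)). If the number N of distinct odd prime divisors of n satisfies N ≥ 3, then the class number of the real quadratic field Q(√d) is at least N + 2. -/
/-- Descent: small norms in `ℤ[√(n²+1)]` are squares. -/
lemma aux_descent (n : ℤ) (hn : 0 < n) (m : ℕ) (hm : ¬ IsSquare m) (hlt : (m : ℤ) < 2 * n) :
    ∀ (k : ℕ) (u v : ℤ), 0 ≤ u → v.natAbs = k → 0 ≤ v →
      |u ^ 2 - (n ^ 2 + 1) * v ^ 2| ≠ (m : ℤ) := by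
  intro k
  induction k using Nat.strong_induction_on with
  | _ k ih =>
    intro u v hu hk hv h
    rcases hv.eq_or_lt with h0 | hpos
    · subst h0
      apply hm
      refine ⟨u.natAbs, ?_⟩
      zify
      rw [← h, abs_mul_abs_self, abs_of_nonneg (by nlinarith [sq_nonneg u])]
      ring
    · have hv2 : 1 ≤ v ^ 2 := by nlinarith
      by_cases h1 : v * (n + 1) ≤ u
      · have : v ^ 2 * (n + 1) ^ 2 ≤ u ^ 2 := by
          rw [← mul_pow]; exact pow_le_pow_left₀ (by positivity) h1 2
        have := le_abs_self (u ^ 2 - (n ^ 2 + 1) * v ^ 2)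
        nlinarith
      · by_cases h2 : u ≤ v * (n - 1)
        · have : u ^ 2 ≤ v ^ 2 * (n - 1) ^ 2 := by
            rw [← mul_pow]; exact pow_le_pow_left₀ hu h2 2
          have := neg_abs_le (u ^ 2 - (n ^ 2 + 1) * v ^ 2)
          nlinarith
        · push Not at h1 h2
          have hlt' : |v * n - u| < v := by
            rw [abs_lt]; constructor <;> linarith
          refine ih (|v * n - u|).natAbs ?_ |u * n - v * (n ^ 2 + 1)| |v * n - u|
            (abs_nonneg _) rfl (abs_nonneg _) ?_
          · have := abs_nonneg (v * n - u)
            omega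
          · rw [sq_abs, sq_abs, ← h, ← abs_neg]
            congr 1
            ring

lemma aux_norm (n : ℤ) (hn : 0 < n) (m : ℕ) (hm : ¬ IsSquare m) (hlt : (m : ℤ) < 2 * n)
    (u v : ℤ) : |u ^ 2 - (n ^ 2 + 1) * v ^ 2| ≠ (m : ℤ) := by
  have := aux_descent n hn m hm hlt _ |u| |v| (abs_nonneg _) rfl (abs_nonneg _)
  simpa using this

lemma aux_int (d : ℕ) (hsf : Squarefree d) (hmod : d % 4 = 2) (u v : ℚ) (U m : ℤ)
    (hU : 2 * u = U) (hm : u ^ 2 - d * v ^ 2 = m) : ∃ a b : ℤ, u = a ∧ v = b := by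
  have hw : (2 * v) ^ 2 * d = ((U ^ 2 - 4 * m : ℤ) : ℚ) := by
    push_cast; rw [← hU, ← hm]; ring
  obtain ⟨W, hW⟩ : ∃ W : ℤ, 2 * v = W := by
    generalize 2 * v = w at hw
    have hden : (w.den : ℚ) ≠ 0 := by exact_mod_cast w.den_nz
    have h1 : w.num ^ 2 * (d : ℤ) = (U ^ 2 - 4 * m) * (w.den : ℤ) ^ 2 := by
      rw [← Rat.num_div_den w] at hw
      field_simp at hw
      rw [mul_comm (U ^ 2 - 4 * m)]
      exact_mod_cast hw
    have h2 : w.den * w.den ∣ d := by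
      have hc : IsCoprime ((w.den : ℤ) ^ 2) (w.num ^ 2) := by
        apply IsCoprime.pow
        rw [Int.isCoprime_iff_nat_coprime]
        simpa using w.reduced.symm
      have : (w.den : ℤ) ^ 2 ∣ d := hc.dvd_of_dvd_mul_left (h1 ▸ Dvd.intro_left _ rfl)
      rw [sq] at this
      exact_mod_cast this
    have h3 : w.den = 1 := Nat.isUnit_iff.mp (hsf _ h2)
    exact ⟨w.num, (Rat.den_eq_one_iff w).mp h3 |>.symm⟩
  have hZ : W ^ 2 * (d : ℤ) = U ^ 2 - 4 * m := by
    rw [hW] at hw; exact_mod_cast hw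
  obtain ⟨e, he⟩ : ∃ e : ℕ, d = 4 * e + 2 := ⟨d / 4, by omega⟩
  have hUe : Even U := by
    by_contra ho
    rw [Int.not_even_iff_odd] at ho
    obtain ⟨t, rfl⟩ := ho
    have : W ^ 2 * (4 * e + 2 : ℤ) = (2 * t + 1) ^ 2 - 4 * m := by rw [← hZ, he]; push_cast; ring
    have h2 : 2 * (W ^ 2 * (2 * e + 1) - 2 * t ^ 2 - 2 * t + 2 * m) = 1 := by linarith
    omega
  obtain ⟨a, rfl⟩ := hUe
  have hWe : Even W := by
    by_contra ho
    rw [Int.not_even_iff_odd] at ho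
    obtain ⟨t, rfl⟩ := ho
    have : (2 * t + 1) ^ 2 * (4 * e + 2 : ℤ) = (a + a) ^ 2 - 4 * m := by
      rw [← hZ, he]; push_cast; ring
    have h2 : 2 * (a ^ 2 - m - (2 * t + 1) ^ 2 * e - 2 * t ^ 2 - 2 * t) = 1 := by linarith
    omega
  obtain ⟨b, rfl⟩ := hWe
  refine ⟨a, b, ?_, ?_⟩
  · push_cast at hU; linarith
  · push_cast at hW; linarith

section
variable {K : Type} [Field K] [NumberField K]

lemma aux_basis (hdeg : Module.finrank ℚ K = 2) (d : ℕ) (hd : ¬ IsSquare d) (α : K)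
    (hα : α ^ 2 = (d : K)) :
    (∀ u v : ℚ, (u : K) + v * α = 0 → u = 0 ∧ v = 0) ∧
    ∀ z : K, ∃ u v : ℚ, z = u + v * α ∧ Algebra.norm ℚ z = u ^ 2 - d * v ^ 2 ∧
      Algebra.trace ℚ K z = 2 * u := by
  have hli : ∀ u v : ℚ, (u : K) + v * α = 0 → u = 0 ∧ v = 0 := by
    intro u v h
    by_cases hv : v = 0
    · subst hv; simpa using h
    · exfalso
      have h1 : ((v ^ 2 * d : ℚ) : K) = ((u ^ 2 : ℚ) : K) := by
        push_cast; rw [← hα]; linear_combination (v * α - u) * h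
      have h2 : v ^ 2 * d = u ^ 2 := Rat.cast_injective h1
      have h3 : IsSquare (d : ℚ) := ⟨u / v, by field_simp; linarith⟩
      exact hd (Rat.isSquare_natCast_iff.mp h3)
  refine ⟨hli, ?_⟩
  have hind : LinearIndependent ℚ ![(1 : K), α] := by
    rw [LinearIndependent.pair_iff]
    intro s t h
    apply hli
    simpa [Algebra.smul_def] using h
  let b := basisOfLinearIndependentOfCardEqFinrank hind (by simp [hdeg])
  have hb0 : b 0 = 1 := by simp [b]
  have hb1 : b 1 = α := by simp [b]
  have hα' : α * α = (d : K) := by rw [← hα, sq]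
  intro z
  have hz : z = (b.repr z 0 : K) + (b.repr z 1 : K) * α := by
    conv_lhs => rw [← b.sum_repr z]
    simp [Fin.sum_univ_two, hb0, hb1, Algebra.smul_def]
  generalize b.repr z 0 = u at hz
  generalize b.repr z 1 = v at hz
  have hM : Algebra.leftMulMatrix b z = !![u, d * v; v, u] := by
    have e0 : z * b 0 = u • b 0 + v • b 1 := by
      rw [hb0, hb1, Algebra.smul_def, Algebra.smul_def, hz]; simp
    have e1 : z * b 1 = (d * v : ℚ) • b 0 + u • b 1 := by
      rw [hb0, hb1, Algebra.smul_def, Algebra.smul_def, hz]; simp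
      linear_combination (v : K) * hα'
    ext i j
    rw [Algebra.leftMulMatrix_eq_repr_mul]
    fin_cases j
    · simp only [Fin.zero_eta, e0]
      fin_cases i <;> simp
    · simp only [Fin.mk_one, e1]
      fin_cases i <;> simp
  refine ⟨u, v, hz, ?_, ?_⟩
  · rw [Algebra.norm_eq_matrix_det b, hM, Matrix.det_fin_two_of]; ring
  · rw [Algebra.trace_eq_matrix_trace b, hM, Matrix.trace_fin_two_of]; ring

open NumberField

lemma aux_repr (hdeg : Module.finrank ℚ K = 2) (d : ℕ) (hd : ¬ IsSquare d)
    (hsf : Squarefree d) (hmod : d % 4 = 2) (α : K)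
    (hα : α ^ 2 = (d : K)) (z : 𝓞 K) :
    ∃ u v : ℤ, (z : K) = u + v * α ∧ Algebra.norm ℤ z = u ^ 2 - d * v ^ 2 := by
  obtain ⟨u, v, h1, h2, h3⟩ := (aux_basis hdeg d hd α hα).2 (z : K)
  have hN : Algebra.norm ℚ (z : K) = (Algebra.norm ℤ z : ℤ) := (Algebra.coe_norm_int z).symm
  have hT : Algebra.trace ℚ K (z : K) = (Algebra.trace ℤ (𝓞 K) z : ℤ) :=
    (Algebra.coe_trace_int z).symm
  obtain ⟨a, b, rfl, rfl⟩ := aux_int d hsf hmod u v _ _ (h3.symm.trans hT) (h2.symm.trans hN)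
  refine ⟨a, b, by simpa using h1, ?_⟩
  rw [hN] at h2
  exact_mod_cast h2

lemma aux_ideal (hdeg : Module.finrank ℚ K = 2) (d : ℕ) (hd : ¬ IsSquare d)
    (hsf : Squarefree d) (hmod : d % 4 = 2) (α : K)
    (hα : α ^ 2 = (d : K)) (p : ℕ) (hp : p.Prime) (t : ℤ) (ht : (p : ℤ) ∣ d - t ^ 2) :
    ∃ I : Ideal (𝓞 K), Ideal.absNorm I = p := by
  have hαi : IsIntegral ℤ α := by
    apply IsIntegral.of_pow (n := 2) (by norm_num)
    rw [hα]
    have := isIntegral_algebraMap (R := ℤ) (A := K) (x := (d : ℤ))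
    simpa using this
  let a : 𝓞 K := ⟨α, hαi⟩
  have ha : (a : K) = α := rfl
  have hnorm : Ideal.absNorm (Ideal.span {(p : 𝓞 K)}) = p ^ 2 := by
    rw [Ideal.absNorm_span_singleton]
    have := Algebra.norm_algebraMap (S := 𝓞 K) (p : ℤ)
    simp only [map_natCast] at this
    rw [this, RingOfIntegers.rank, hdeg]
    simp [Int.natAbs_pow]
  have hne : Ideal.span {(p : 𝓞 K)} ≠ ⊤ := by
    intro h
    rw [h, Ideal.absNorm_top] at hnorm
    have := hp.one_lt
    nlinarith
  obtain ⟨P, hP, hle⟩ := Ideal.exists_le_maximal _ hne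
  have hdvd : Ideal.absNorm P ∣ p ^ 2 := hnorm ▸ Ideal.absNorm_dvd_absNorm_of_le hle
  obtain ⟨k, hk, hk'⟩ := (Nat.dvd_prime_pow hp).mp hdvd
  interval_cases k
  · exact absurd (Ideal.absNorm_eq_one_iff.mp (by simpa using hk')) hP.ne_top
  · exact ⟨P, by simpa using hk'⟩
  · exfalso
    have hdv : P ∣ Ideal.span {(p : 𝓞 K)} := Ideal.dvd_iff_le.mpr hle
    obtain ⟨J, hJ⟩ := hdv
    have hJ1 : Ideal.absNorm J = 1 := by
      have := congrArg Ideal.absNorm hJ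
      rw [map_mul, hnorm, hk'] at this
      have hpp : 0 < p ^ 2 := pow_pos hp.pos 2
      exact Nat.eq_of_mul_eq_mul_left hpp (by linarith)
    rw [Ideal.absNorm_eq_one_iff.mp hJ1, Ideal.mul_top] at hJ
    have key : ∀ s : ℤ, ¬ (a - (s : 𝓞 K)) ∈ P := by
      intro s hs
      rw [← hJ, Ideal.mem_span_singleton] at hs
      obtain ⟨z, hz⟩ := hs
      obtain ⟨u, v, h1, -⟩ := aux_repr hdeg d hd hsf hmod α hα z
      have h2 := congrArg (algebraMap (𝓞 K) K) hz
      simp only [map_sub, map_mul, map_intCast, map_natCast] at h2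
      change α - s = p * (z : K) at h2
      rw [h1] at h2
      have := (aux_basis hdeg d hd α hα).1 (-s - p * u) (1 - p * v)
        (by push_cast; linear_combination h2)
      have h3 : (p : ℤ) * v = 1 := by
        have := this.2
        have h4 : (p : ℚ) * v = 1 := by linarith
        exact_mod_cast h4
      have h5 : (p : ℤ) ∣ 1 := Dvd.intro _ h3
      exact hp.one_lt.ne' (by exact_mod_cast Int.eq_one_of_dvd_one (by positivity) h5)
    have hmem : (a - (t : 𝓞 K)) * (a - ((-t : ℤ) : 𝓞 K)) ∈ P := by
      have : (a - (t : 𝓞 K)) * (a - ((-t : ℤ) : 𝓞 K)) = (((d : ℤ) - t ^ 2 : ℤ) : 𝓞 K) := by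
        apply RingOfIntegers.coe_injective
        simp only [map_sub, map_mul, map_intCast]
        change (α - t) * (α - ((-t : ℤ) : K)) = _
        push_cast
        rw [← hα]; ring
      rw [this]
      obtain ⟨c, hc⟩ := ht
      rw [hc, Int.cast_mul]
      apply P.mul_mem_right
      apply hle
      simp
    rcases hP.isPrime.mem_or_mem hmem with h | h
    · exact key _ h
    · exact key _ h

lemma aux_class (hdeg : Module.finrank ℚ K = 2) (I J : (nonZeroDivisors (Ideal (𝓞 K))))
    (h : ClassGroup.mk0 I = ClassGroup.mk0 J) :
    ∃ z : 𝓞 K, (Algebra.norm ℤ z).natAbs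
      = Ideal.absNorm (I : Ideal (𝓞 K)) * Ideal.absNorm (J : Ideal (𝓞 K)) := by
  obtain ⟨x, y, hx, hy, hxy⟩ := ClassGroup.mk0_eq_mk0_iff.mp h
  set i := Ideal.absNorm (I : Ideal (𝓞 K))
  set j := Ideal.absNorm (J : Ideal (𝓞 K))
  have hi0 : i ≠ 0 := by
    have := nonZeroDivisors.ne_zero I.2
    simpa [i, Ideal.absNorm_eq_zero_iff] using this
  have hmem : x * (i : 𝓞 K) ∈ Ideal.span {y} * (J : Ideal (𝓞 K)) := by
    rw [← hxy]
    exact Ideal.mul_mem_mul (Ideal.mem_span_singleton_self x) (Ideal.absNorm_mem _)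
  obtain ⟨z, hz, hzx⟩ := Ideal.mem_span_singleton_mul.mp hmem
  refine ⟨z, ?_⟩
  have hn := congrArg Ideal.absNorm hxy
  simp only [map_mul, Ideal.absNorm_span_singleton] at hn
  have hz2 := congrArg (fun w => (Algebra.norm ℤ w).natAbs) hzx
  simp only [map_mul, Int.natAbs_mul] at hz2
  have hin : (Algebra.norm ℤ (i : 𝓞 K)).natAbs = i ^ Module.finrank ℚ K := by
    have := Algebra.norm_algebraMap (S := 𝓞 K) (i : ℤ)
    simp only [map_natCast] at this
    rw [this, RingOfIntegers.rank]
    simp [Int.natAbs_pow]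
  rw [hin, hdeg] at hz2
  have hy0 : 0 < (Algebra.norm ℤ y).natAbs := by
    rw [Int.natAbs_pos]
    exact Algebra.norm_ne_zero_iff.mpr hy
  apply Nat.eq_of_mul_eq_mul_left hy0
  rw [hz2]
  change _ * i = _ * j at hn
  linear_combination i * hn
end

/-- If `d = n^2 + 1` is squarefree with `d ≡ 2 (mod 4)` and `n` has at least
`N ≥ 3` distinct odd prime divisors, then the class number of `ℚ(√d)` is at
least `N + 2`. -/
theorem class_number_lower_bound_two_mod_four
    (n : ℕ) (hn : 0 < n) (d : ℕ) (hd : d = n ^ 2 + 1)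
    (hsf : Squarefree d) (hmod : d % 4 = 2)
    (hN : 3 ≤ (n.primeFactors.filter fun p => p ≠ 2).card)
    (K : Type) [Field K] [NumberField K]
    (hdeg : Module.finrank ℚ K = 2) (α : K) (hα : α ^ 2 = (d : K)) :
    (n.primeFactors.filter fun p => p ≠ 2).card + 2 ≤ NumberField.classNumber K := by
  classical
  set S := n.primeFactors.filter fun p => p ≠ 2 with hS
  have hdsq : ¬ IsSquare d := by
    rintro ⟨r, hr⟩
    have h1 : n < r := by nlinarith
    nlinarith
  have hSmem : ∀ p ∈ S, p.Prime ∧ p ∣ n ∧ p ≠ 2 := by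
    intro p hp
    simp only [hS, Finset.mem_filter, Nat.mem_primeFactors] at hp
    tauto
  have hlt : ∀ p ∈ S, p < n := by
    intro p hp
    obtain ⟨h1, h2, h3⟩ := hSmem p hp
    refine lt_of_le_of_ne (Nat.le_of_dvd hn h2) ?_
    rintro rfl
    have : S.card ≤ 1 := by
      calc S.card ≤ p.primeFactors.card := Finset.card_filter_le _ _
        _ ≤ 1 := by rw [h1.primeFactors]; simp
    omega
  have hn3 : 3 < n := by
    obtain ⟨p, hp⟩ := Finset.card_pos.mp (by omega : 0 < S.card)
    have h := hlt p hp
    obtain ⟨h1, h2, h3⟩ := hSmem p hp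
    have := h1.two_le
    omega
  let T : Finset ℕ := insert 1 (insert 2 S)
  have h2S : 2 ∉ S := fun h => (hSmem 2 h).2.2 rfl
  have h1S : 1 ∉ insert 2 S := by
    intro h
    rcases Finset.mem_insert.mp h with h | h
    · omega
    · exact Nat.not_prime_one (hSmem 1 h).1
  have hT : T.card = S.card + 2 := by
    simp only [T]
    rw [Finset.card_insert_of_notMem h1S, Finset.card_insert_of_notMem h2S]
  have hTpos : ∀ a ∈ T, a ≠ 0 := by
    intro a ha
    rcases Finset.mem_insert.mp ha with h | h
    · omega
    rcases Finset.mem_insert.mp h with h | h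
    · omega
    · exact (hSmem a h).1.ne_zero
  have hI : ∀ a ∈ T, ∃ I : Ideal (NumberField.RingOfIntegers K), Ideal.absNorm I = a := by
    intro a ha
    rcases Finset.mem_insert.mp ha with h | h
    · exact ⟨⊤, by rw [Ideal.absNorm_top, h]⟩
    rcases Finset.mem_insert.mp h with h | h
    · exact aux_ideal hdeg d hdsq hsf hmod α hα a (h ▸ Nat.prime_two) 0 (by subst h; push_cast; omega)
    · obtain ⟨h1, h2, h3⟩ := hSmem a h
      refine aux_ideal hdeg d hdsq hsf hmod α hα a h1 1 ?_
      rw [hd]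
      push_cast
      have : (a : ℤ) ∣ n := by exact_mod_cast h2
      simpa using this.pow two_ne_zero
  have hprod : ∀ a ∈ T, ∀ b ∈ T, a < b → ¬ IsSquare (a * b) ∧ a * b < 2 * n := by
    have hsq : ∀ a b : ℕ, a.Prime → b.Prime → a < b → ¬ IsSquare (a * b) := by
      rintro a b ha hb hab ⟨r, hr⟩
      have h1 : a ∣ r := by
        have : a ∣ r * r := hr ▸ Dvd.intro _ rfl
        exact (ha.dvd_mul.mp this).elim id id
      obtain ⟨c, rfl⟩ := h1
      have h2 : b = a * (c * c) := Nat.eq_of_mul_eq_mul_left ha.pos (by linarith)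
      have h3 : a ∣ b := Dvd.intro _ h2.symm
      have := (Nat.prime_dvd_prime_iff_eq ha hb).mp h3
      omega
    have hone : ∀ b : ℕ, b.Prime → ¬ IsSquare (1 * b) := by
      intro b hb
      rw [one_mul]
      exact hb.prime.irreducible.not_isSquare
    intro a ha b hb hab
    rcases Finset.mem_insert.mp ha with rfl | ha
    · rcases Finset.mem_insert.mp hb with rfl | hb
      · omega
      rcases Finset.mem_insert.mp hb with rfl | hb
      · exact ⟨hone 2 Nat.prime_two, by omega⟩
      · exact ⟨hone b (hSmem b hb).1, by have := hlt b hb; omega⟩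
    · have hbS : b ∈ S := by
        rcases Finset.mem_insert.mp hb with rfl | hb
        · exact absurd hab (by have := hTpos a (Finset.mem_insert_of_mem ha); omega)
        rcases Finset.mem_insert.mp hb with rfl | hb
        · rcases Finset.mem_insert.mp ha with rfl | ha
          · omega
          · have := (hSmem a ha).1.two_le; omega
        · exact hb
      obtain ⟨b1, b2, b3⟩ := hSmem b hbS
      rcases Finset.mem_insert.mp ha with rfl | ha
      · exact ⟨hsq 2 b Nat.prime_two b1 hab, by have := hlt b hbS; omega⟩
      · obtain ⟨a1, a2, a3⟩ := hSmem a ha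
        refine ⟨hsq a b a1 b1 hab, ?_⟩
        have : a * b ∣ n :=
          ((Nat.coprime_primes a1 b1).mpr hab.ne).mul_dvd_of_dvd_of_dvd a2 b2
        have := Nat.le_of_dvd hn this
        omega
  choose! I hI using hI
  have hI0 : ∀ a ∈ T, I a ∈ nonZeroDivisors (Ideal (NumberField.RingOfIntegers K)) := by
    intro a ha
    rw [mem_nonZeroDivisors_iff_ne_zero]
    intro h0
    apply hTpos a ha
    rw [← hI a ha, h0]
    simp
  let f : T → ClassGroup (NumberField.RingOfIntegers K) :=
    fun a => ClassGroup.mk0 ⟨I a, hI0 a a.2⟩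
  have hne : ∀ a b : T, (a : ℕ) < b → f a ≠ f b := by
    intro a b hab h
    obtain ⟨z, hz⟩ := aux_class hdeg _ _ h
    simp only [hI _ a.2, hI _ b.2] at hz
    obtain ⟨u, v, -, huv⟩ := aux_repr hdeg d hdsq hsf hmod α hα z
    obtain ⟨h1, h2⟩ := hprod a a.2 b b.2 hab
    apply aux_norm n (by exact_mod_cast hn) (a * b) h1 (by exact_mod_cast h2) u v
    rw [← hz, huv, hd]
    push_cast
    rfl
  have hinj : Function.Injective f := by
    intro a b h
    rcases lt_trichotomy (a : ℕ) b with h1 | h1 | h1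
    · exact absurd h (hne a b h1)
    · exact Subtype.ext h1
    · exact absurd h.symm (hne b a h1)
  have := Fintype.card_le_of_injective f hinj
  rw [Fintype.card_coe, hT] at this
  exact this
end

section
/- Let n be a positive integer such that d = n^2 + 1 is squarefree and d ≡ 5 (mod 8). If the number N of distinct odd prime divisors of n satisfies N ≥ 3, then the class number of the real quadratic field Q(√d) is at least N + 1. -/
namespace CNLB
open NumberField

/-- Descent: small norms are squares. -/
lemma descent (m t : ℕ) (ht : t < m) : ∀ (b : ℕ) (a : ℤ),
    |a ^ 2 - ((2 * m : ℤ) ^ 2 + 1) * (b : ℤ) ^ 2| = 4 * (t : ℤ) → IsSquare t := by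
  intro b
  induction b using Nat.strong_induction_on with
  | _ b ih =>
  intro a h
  rcases Nat.eq_zero_or_pos b with hb | hb
  · subst hb
    have h1 : a ^ 2 = 4 * t := by
      rw [← h]; simp
    have h2 : Even a := by
      have : Even (a ^ 2) := by rw [h1]; exact ⟨2 * t, by ring⟩
      exact (Int.even_pow.mp this).1
    obtain ⟨c, rfl⟩ := h2
    refine ⟨c.natAbs, ?_⟩
    zify
    have : (t : ℤ) = c * c := by nlinarith
    rw [this, abs_mul_abs_self]
  · have hb' : (1 : ℤ) ≤ b := by exact_mod_cast hb
    have htm : (t : ℤ) + 1 ≤ m := by exact_mod_cast ht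
    have ht0 : (0 : ℤ) ≤ t := by positivity
    have hbb : (1 : ℤ) ≤ (b : ℤ) ^ 2 := by nlinarith
    have hA : |a| ^ 2 = a ^ 2 := sq_abs a
    have hA0 : 0 ≤ |a| := abs_nonneg a
    generalize |a| = A at hA hA0
    rw [← hA] at h
    have hle := abs_le.mp h.le
    have hmb : (m : ℤ) ≤ m * (b : ℤ) ^ 2 := by nlinarith
    have hup : A < (2 * m + 1) * b := by
      apply lt_of_pow_lt_pow_left₀ 2 (by positivity)
      nlinarith [hle.2]
    have hlo : (2 * m - 1) * b < A := by
      apply lt_of_pow_lt_pow_left₀ 2 hA0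
      nlinarith [hle.1]
    refine ih (A - 2 * m * b).natAbs ?_ (b * ((2 * m : ℤ) ^ 2 + 1) - A * (2 * m)) ?_
    · zify
      rw [abs_lt]
      constructor <;> nlinarith
    · rw [← h, ← abs_neg]
      congr 1
      push_cast
      rw [sq_abs]
      ring

section field
variable {K : Type} [Field K] [NumberField K]

lemma norm_trace (d : ℕ) (hns : ¬ IsSquare d)
    (hdeg : Module.finrank ℚ K = 2) (α : K) (hα : α ^ 2 = (d : K)) :
    (∀ x : K, ∃ u v : ℚ, x = algebraMap ℚ K u + algebraMap ℚ K v * α) ∧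
    ∀ u v : ℚ, Algebra.norm ℚ (algebraMap ℚ K u + algebraMap ℚ K v * α) = u ^ 2 - d * v ^ 2 ∧
      Algebra.trace ℚ K (algebraMap ℚ K u + algebraMap ℚ K v * α) = 2 * u := by
  have hq : ∀ q : ℚ, q ^ 2 ≠ d := by
    intro q hq
    apply hns
    have : IsSquare ((d : ℕ) : ℚ) := ⟨q, by rw [← hq]; ring⟩
    exact Rat.isSquare_natCast_iff.mp this
  have hli : LinearIndependent ℚ ![(1 : K), α] := by
    rw [LinearIndependent.pair_iff]
    intro s t hst
    rw [Algebra.smul_def, Algebra.smul_def, mul_one] at hst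
    have ht : t = 0 := by
      by_contra ht
      apply hq (s / t)
      apply (algebraMap ℚ K).injective
      have ht' : algebraMap ℚ K t ≠ 0 := by simpa using ht
      have : algebraMap ℚ K s = - (algebraMap ℚ K t * α) := by linear_combination hst
      rw [map_pow, map_div₀, this, map_natCast, ← hα]
      field_simp
    subst ht
    simpa using hst
  let B := basisOfLinearIndependentOfCardEqFinrank hli (by simp [hdeg])
  have hB0 : B 0 = 1 := by simp [B]
  have hB1 : B 1 = α := by simp [B]
  have hrep : ∀ u v : ℚ, B.repr (algebraMap ℚ K u + algebraMap ℚ K v * α) 0 = u ∧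
      B.repr (algebraMap ℚ K u + algebraMap ℚ K v * α) 1 = v := by
    intro u v
    have : algebraMap ℚ K u + algebraMap ℚ K v * α = u • B 0 + v • B 1 := by
      rw [hB0, hB1, Algebra.smul_def, Algebra.smul_def, mul_one]
    rw [this]
    simp
  refine ⟨fun x => ⟨B.repr x 0, B.repr x 1, ?_⟩, fun u v => ?_⟩
  · conv_lhs => rw [← B.sum_repr x]
    rw [Fin.sum_univ_two, hB0, hB1, Algebra.smul_def, Algebra.smul_def, mul_one]
  · have e0 : (algebraMap ℚ K u + algebraMap ℚ K v * α) * B 0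
        = algebraMap ℚ K u + algebraMap ℚ K v * α := by rw [hB0, mul_one]
    have e1 : (algebraMap ℚ K u + algebraMap ℚ K v * α) * B 1
        = algebraMap ℚ K (d * v) + algebraMap ℚ K u * α := by
      rw [hB1, map_mul, map_natCast, ← hα]; ring
    constructor
    · rw [Algebra.norm_eq_matrix_det B, Matrix.det_fin_two]
      simp only [Algebra.leftMulMatrix_eq_repr_mul, e0, e1, hrep]
      ring
    · rw [Algebra.trace_eq_matrix_trace B, Matrix.trace_fin_two]
      simp only [Algebra.leftMulMatrix_eq_repr_mul, e0, e1, hrep]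
      ring

/-- norms of integers are of the form `(a^2 - d b^2)/4`. -/
lemma norm_form (d : ℕ) (hsf : Squarefree d) (hns : ¬ IsSquare d)
    (hdeg : Module.finrank ℚ K = 2) (α : K) (hα : α ^ 2 = (d : K)) (x : 𝓞 K) :
    ∃ a b : ℤ, a ^ 2 - d * b ^ 2 = 4 * Algebra.norm ℤ x := by
  obtain ⟨h1, h2⟩ := norm_trace d hns hdeg α hα
  obtain ⟨u, v, hx⟩ := h1 (x : K)
  obtain ⟨hN, hT⟩ := h2 u v
  rw [← hx] at hN hT
  rw [← Algebra.coe_norm_int] at hN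
  rw [← Algebra.coe_trace_int] at hT
  set a := Algebra.trace ℤ (𝓞 K) x
  set N := Algebra.norm ℤ x
  -- `d (2v)^2` is an integer
  have hw : (d : ℚ) * (2 * v) ^ 2 = ((a ^ 2 - 4 * N : ℤ) : ℚ) := by
    push_cast; rw [hN, hT]; ring
  obtain ⟨b, hb⟩ : ∃ b : ℤ, (b : ℚ) = 2 * v := by
    generalize 2 * v = w at hw
    have hden : (w.den : ℚ) ≠ 0 := by exact_mod_cast w.den_nz
    have h3 : (d : ℤ) * w.num ^ 2 = (a ^ 2 - 4 * N) * (w.den : ℤ) ^ 2 := by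
      have : (d : ℚ) * (w.num : ℚ) ^ 2 = ((a ^ 2 - 4 * N : ℤ) : ℚ) * (w.den : ℚ) ^ 2 := by
        rw [← hw, ← Rat.mul_den_eq_num w]
        ring
      exact_mod_cast this
    have h4 : (w.den : ℤ) ^ 2 ∣ (d : ℤ) * w.num ^ 2 := ⟨a ^ 2 - 4 * N, by rw [h3]; ring⟩
    have hc : IsCoprime ((w.den : ℤ) ^ 2) (w.num ^ 2) := by
      apply IsCoprime.pow
      rw [Int.isCoprime_iff_nat_coprime]
      simpa using w.reduced.symm
    have h5 : (w.den : ℤ) ^ 2 ∣ (d : ℤ) := hc.dvd_of_dvd_mul_right h4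
    have h6 : w.den ^ 2 ∣ d := by exact_mod_cast h5
    have h7 : w.den = 1 := Nat.isUnit_iff.mp (hsf w.den (by rwa [← sq]))
    exact ⟨w.num, (Rat.den_eq_one_iff w).mp h7⟩
  refine ⟨a, b, ?_⟩
  have : ((a ^ 2 - d * b ^ 2 : ℤ) : ℚ) = ((4 * N : ℤ) : ℚ) := by
    push_cast
    rw [hb]
    push_cast at hw
    rw [hw]; ring
  exact_mod_cast this

lemma small_norm (m d : ℕ) (hd : d = (2 * m) ^ 2 + 1) (hsf : Squarefree d) (hns : ¬ IsSquare d)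
    (hdeg : Module.finrank ℚ K = 2) (α : K) (hα : α ^ 2 = (d : K)) (I : Ideal (𝓞 K))
    (hI : I.IsPrincipal) (hlt : Ideal.absNorm I < m) : IsSquare (Ideal.absNorm I) := by
  obtain ⟨x, hx⟩ := hI
  obtain ⟨a, b, hab⟩ := norm_form d hsf hns hdeg α hα x
  apply descent m _ hlt b.natAbs a
  have : Ideal.absNorm I = (Algebra.norm ℤ x).natAbs := by
    rw [hx]; exact Ideal.absNorm_span_singleton x
  rw [this, Int.natCast_natAbs, Int.natCast_natAbs, sq_abs]
  have h2 : (((2 * m : ℤ)) ^ 2 + 1) = d := by rw [hd]; push_cast; ring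
  rw [h2, hab, abs_mul]
  norm_num

lemma prime_ideal (n d : ℕ) (hd : d = n ^ 2 + 1) (hns : ¬ IsSquare d)
    (hdeg : Module.finrank ℚ K = 2) (a : 𝓞 K) (hα : (a : K) ^ 2 = (d : K))
    (p : ℕ) (hp : p.Prime) (hp2 : p ≠ 2) (hpn : p ∣ n) :
    (Ideal.span {(p : 𝓞 K), 1 + a} * Ideal.span {(p : 𝓞 K), 1 - a} = Ideal.span {(p : 𝓞 K)}) ∧
    Ideal.absNorm (Ideal.span {(p : 𝓞 K), 1 + a}) = p ∧
    Ideal.absNorm (Ideal.span {(p : 𝓞 K), 1 - a}) = p := by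
  have ha : a ^ 2 = (d : 𝓞 K) := by
    apply RingOfIntegers.ext
    simpa using hα
  obtain ⟨k, hk⟩ := hpn
  have hd' : (d : 𝓞 K) = (p * k) ^ 2 + 1 := by rw [hd, hk]; push_cast; ring
  rw [hd'] at ha
  obtain ⟨r, hr⟩ : ∃ r, p = 2 * r + 1 := hp.odd_of_ne_two hp2
  have hr' : (p : 𝓞 K) = 2 * r + 1 := by exact_mod_cast congrArg (Nat.cast (R := 𝓞 K)) hr
  have hmul : Ideal.span {(p : 𝓞 K), 1 + a} * Ideal.span {(p : 𝓞 K), 1 - a}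
      = Ideal.span {(p : 𝓞 K)} := by
    rw [Ideal.span_pair_mul_span_pair]
    apply le_antisymm
    · rw [Ideal.span_le]
      intro z hz
      simp only [Set.mem_insert_iff, Set.mem_singleton_iff] at hz
      simp only [SetLike.mem_coe, Ideal.mem_span_singleton]
      rcases hz with rfl | rfl | rfl | rfl
      · exact ⟨_, rfl⟩
      · exact ⟨_, rfl⟩
      · exact ⟨1 + a, by ring⟩
      · exact ⟨- (p * k ^ 2), by linear_combination -ha⟩
    · rw [Ideal.span_singleton_le_iff_mem]
      have e : (p : 𝓞 K) = p * p - r * (p * (1 - a) + (1 + a) * p) := by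
        linear_combination (-(p : 𝓞 K)) * hr'
      have h1 : (p : 𝓞 K) * p ∈ Ideal.span {(p : 𝓞 K) * p, p * (1 - a), (1 + a) * p, (1 + a) * (1 - a)} :=
        Ideal.subset_span (by simp)
      have h2 : (p : 𝓞 K) * (1 - a) ∈ Ideal.span {(p : 𝓞 K) * p, p * (1 - a), (1 + a) * p, (1 + a) * (1 - a)} :=
        Ideal.subset_span (by simp)
      have h3 : (1 + a) * (p : 𝓞 K) ∈ Ideal.span {(p : 𝓞 K) * p, p * (1 - a), (1 + a) * p, (1 + a) * (1 - a)} :=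
        Ideal.subset_span (by simp)
      have := Ideal.sub_mem _ h1 (Ideal.mul_mem_left _ (r : 𝓞 K) (Ideal.add_mem _ h2 h3))
      rwa [← e] at this
  -- trace argument
  have htr : ∀ s : ℤ, ¬ ((p : 𝓞 K) ∣ 1 + s * a) := by
    rintro s ⟨y, hy⟩
    obtain ⟨-, h2⟩ := norm_trace d hns hdeg (a : K) hα
    have h3 := (h2 1 s).2
    have h4 : algebraMap ℚ K 1 + algebraMap ℚ K s * (a : K) = (((1 + s * a : 𝓞 K)) : K) := by
      simp
    rw [h4, ← Algebra.coe_trace_int, hy, ← nsmul_eq_mul, map_nsmul] at h3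
    have h5 : (p : ℤ) * Algebra.trace ℤ (𝓞 K) y = 2 := by
      rw [nsmul_eq_mul] at h3
      have : (((p : ℤ) * Algebra.trace ℤ (𝓞 K) y : ℤ) : ℚ) = ((2 : ℤ) : ℚ) := by
        rw [← mul_one ((2 : ℤ) : ℚ)]
        exact_mod_cast h3
      exact_mod_cast this
    have h6 : (p : ℤ) ∣ (2 : ℕ) := ⟨_, h5.symm⟩
    have h7 : p ∣ 2 := by exact_mod_cast h6
    exact hp2 ((Nat.prime_dvd_prime_iff_eq hp Nat.prime_two).mp h7)
  have hn : Ideal.absNorm (Ideal.span {(p : 𝓞 K), 1 + a}) *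
      Ideal.absNorm (Ideal.span {(p : 𝓞 K), 1 - a}) = p ^ 2 := by
    rw [← map_mul, hmul, Ideal.absNorm_span_singleton]
    have : Algebra.norm ℤ (p : 𝓞 K) = (p : ℤ) ^ 2 := by
      have := Algebra.norm_algebraMap (S := 𝓞 K) (p : ℤ)
      rw [RingOfIntegers.rank, hdeg] at this
      simpa using this
    rw [this]
    simp [Int.natAbs_pow]
  have hne1 : Ideal.absNorm (Ideal.span {(p : 𝓞 K), 1 + a}) ≠ 1 := by
    intro h
    rw [Ideal.absNorm_eq_one_iff] at h
    rw [h, Ideal.top_mul] at hmul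
    apply htr (-1)
    rw [← Ideal.mem_span_singleton, ← hmul]
    apply Ideal.subset_span
    simp [sub_eq_add_neg]
  have hne2 : Ideal.absNorm (Ideal.span {(p : 𝓞 K), 1 - a}) ≠ 1 := by
    intro h
    rw [Ideal.absNorm_eq_one_iff] at h
    rw [h, Ideal.mul_top] at hmul
    apply htr 1
    rw [← Ideal.mem_span_singleton, ← hmul]
    apply Ideal.subset_span
    simp
  exact ⟨hmul, (Nat.Prime.mul_eq_prime_sq_iff hp hne1 hne2).mp hn⟩

end field

lemma not_sq_prime_mul {p q : ℕ} (hp : p.Prime) (hq : q.Prime) (hpq : p ≠ q) :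
    ¬ IsSquare (p * q) := by
  rintro ⟨r, hr⟩
  have h1 : p ∣ r := (hp.dvd_mul.mp (hr ▸ Dvd.intro _ rfl : p ∣ r * r)).elim id id
  obtain ⟨c, rfl⟩ := h1
  have h2 : q = p * (c * c) := by
    apply Nat.eq_of_mul_eq_mul_left hp.pos
    rw [hr]; ring
  exact hpq ((Nat.prime_dvd_prime_iff_eq hp hq).mp ⟨_, h2⟩)

end CNLB

/-- If `d = n^2 + 1` is squarefree with `d ≡ 5 (mod 8)` and `n` has at least
`N ≥ 3` distinct odd prime divisors, then the class number of `ℚ(√d)` is at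
least `N + 1`. -/
theorem class_number_lower_bound_five_mod_eight
    (n : ℕ) (hn : 0 < n) (d : ℕ) (hd : d = n ^ 2 + 1)
    (hsf : Squarefree d) (hmod : d % 8 = 5)
    (hN : 3 ≤ (n.primeFactors.filter fun p => p ≠ 2).card)
    (K : Type) [Field K] [NumberField K]
    (hdeg : Module.finrank ℚ K = 2) (α : K) (hα : α ^ 2 = (d : K)) :
    (n.primeFactors.filter fun p => p ≠ 2).card + 1 ≤ NumberField.classNumber K := by
  classical
  have hns : ¬ IsSquare d := by
    rintro ⟨r, hr⟩
    have h1 : n < r := by nlinarith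
    nlinarith
  have heven : Even n := by
    by_contra h
    rw [Nat.not_even_iff_odd] at h
    obtain ⟨k, rfl⟩ := h
    have : d = 2 * (2 * k ^ 2 + 2 * k + 1) := by rw [hd]; ring
    omega
  obtain ⟨m, hm⟩ : ∃ m, n = 2 * m := heven.two_dvd
  have hint : IsIntegral ℤ α := by
    refine ⟨Polynomial.X ^ 2 - Polynomial.C (d : ℤ), Polynomial.monic_X_pow_sub_C _ (by norm_num), ?_⟩
    simp [hα]
  let a : NumberField.RingOfIntegers K := ⟨α, hint⟩
  have haα : (a : K) = α := rfl
  set S := n.primeFactors.filter fun p => p ≠ 2 with hS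
  have hSm : ∀ p ∈ S, p.Prime ∧ p ≠ 2 ∧ p ∣ n := by
    intro p hp
    simp only [hS, Finset.mem_filter, Nat.mem_primeFactors] at hp
    tauto
  have hlt : ∀ p ∈ S, ∀ q ∈ S, p ≠ q → p * q < m := by
    intro p hp q hq hpq
    obtain ⟨r, hr, hrp⟩ : ∃ r ∈ S, r ∉ ({p, q} : Finset ℕ) := by
      apply Finset.exists_mem_notMem_of_card_lt_card
      have := Finset.card_le_two (a := p) (b := q)
      omega
    simp only [Finset.mem_insert, Finset.mem_singleton, not_or] at hrp
    obtain ⟨hp1, hp2, hp3⟩ := hSm p hp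
    obtain ⟨hq1, hq2, hq3⟩ := hSm q hq
    obtain ⟨hr1, hr2, hr3⟩ := hSm r hr
    have key : ∀ x, x.Prime → x ≠ 2 → x ∣ n → x ∣ m := by
      intro x hx hx2 hxn
      rw [hm] at hxn
      exact ((Nat.coprime_primes hx Nat.prime_two).mpr hx2).dvd_of_dvd_mul_left hxn
    have c1 : Nat.Coprime p q := (Nat.coprime_primes hp1 hq1).mpr hpq
    have c2 : Nat.Coprime (p * q) r := Nat.Coprime.mul_left
      ((Nat.coprime_primes hp1 hr1).mpr (Ne.symm hrp.1))
      ((Nat.coprime_primes hq1 hr1).mpr (Ne.symm hrp.2))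
    have h := c2.mul_dvd_of_dvd_of_dvd
      (c1.mul_dvd_of_dvd_of_dvd (key p hp1 hp2 hp3) (key q hq1 hq2 hq3)) (key r hr1 hr2 hr3)
    have hle := Nat.le_of_dvd (by omega) h
    have := hr1.two_le
    have : 0 < p * q := Nat.mul_pos hp1.pos hq1.pos
    nlinarith
  have hlt1 : ∀ p ∈ S, p < m := by
    intro p hp
    obtain ⟨q, hq, hqp⟩ := Finset.exists_mem_ne (by omega : 1 < S.card) p
    have := hlt p hp q hq hqp.symm
    have := (hSm q hq).1.pos
    nlinarith
  have hm2 : d = (2 * m) ^ 2 + 1 := by rw [hd, hm]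
  -- the ideals
  let P : ℕ → Ideal (NumberField.RingOfIntegers K) := fun p => Ideal.span {(p : NumberField.RingOfIntegers K), 1 + a}
  let Q : ℕ → Ideal (NumberField.RingOfIntegers K) := fun p => Ideal.span {(p : NumberField.RingOfIntegers K), 1 - a}
  have hPQ : ∀ p ∈ S, P p * Q p = Ideal.span {(p : NumberField.RingOfIntegers K)} ∧
      Ideal.absNorm (P p) = p ∧ Ideal.absNorm (Q p) = p := fun p hp =>
    CNLB.prime_ideal n d hd hns hdeg a hα p (hSm p hp).1 (hSm p hp).2.1 (hSm p hp).2.2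
  have hane : ∀ s : NumberField.RingOfIntegers K, a = s → s ^ 2 = 1 → False := by
    rintro s rfl h
    have h1 : (a : K) ^ 2 = 1 := by
      have := congrArg (algebraMap (NumberField.RingOfIntegers K) K) h
      simpa using this
    rw [haα, hα] at h1
    have : d = 1 := by exact_mod_cast h1
    omega
  have hP0 : ∀ p, P p ∈ nonZeroDivisors (Ideal (NumberField.RingOfIntegers K)) := by
    intro p
    apply mem_nonZeroDivisors_of_ne_zero
    intro h
    have h1 : 1 + a ∈ P p := Ideal.subset_span (by simp)
    rw [h] at h1
    exact hane (-1) (by linear_combination (Ideal.mem_bot.mp h1)) (by ring)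
  have hQ0 : ∀ p, Q p ∈ nonZeroDivisors (Ideal (NumberField.RingOfIntegers K)) := by
    intro p
    apply mem_nonZeroDivisors_of_ne_zero
    intro h
    have h1 : 1 - a ∈ Q p := Ideal.subset_span (by simp)
    rw [h] at h1
    exact hane 1 (by linear_combination -(Ideal.mem_bot.mp h1)) (by ring)
  let f : ℕ → ClassGroup (NumberField.RingOfIntegers K) := fun p => ClassGroup.mk0 ⟨P p, hP0 p⟩
  let g : ℕ → ClassGroup (NumberField.RingOfIntegers K) := fun p => ClassGroup.mk0 ⟨Q p, hQ0 p⟩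
  have hfg : ∀ p ∈ S, f p * g p = 1 := by
    intro p hp
    simp only [f, g]
    rw [← map_mul, ClassGroup.mk0_eq_one_iff]
    refine ⟨(p : NumberField.RingOfIntegers K), ?_⟩
    exact (hPQ p hp).1
  have hf1 : ∀ p ∈ S, f p ≠ 1 := by
    intro p hp h
    simp only [f] at h
    rw [ClassGroup.mk0_eq_one_iff] at h
    have h1 := CNLB.small_norm m d hm2 hsf hns hdeg α hα (P p) h
      (by rw [(hPQ p hp).2.1]; exact hlt1 p hp)
    rw [(hPQ p hp).2.1] at h1
    exact (hSm p hp).1.prime.irreducible.not_isSquare h1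
  have hinj : Set.InjOn f S := by
    intro p hp q hq h
    by_contra hpq
    have h1 : f p * g q = 1 := by rw [h]; exact hfg q hq
    simp only [f, g] at h1
    rw [← map_mul, ClassGroup.mk0_eq_one_iff] at h1
    have hnorm : Ideal.absNorm (P p * Q q) = p * q := by
      rw [map_mul, (hPQ p hp).2.1, (hPQ q hq).2.2]
    have h2 := CNLB.small_norm m d hm2 hsf hns hdeg α hα (P p * Q q) h1
      (by rw [hnorm]; exact hlt p hp q hq hpq)
    rw [hnorm] at h2
    exact CNLB.not_sq_prime_mul (hSm p hp).1 (hSm q hq).1 hpq h2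
  have hcard : (insert 1 (S.image f)).card = S.card + 1 := by
    rw [Finset.card_insert_of_notMem, Finset.card_image_of_injOn hinj]
    intro h
    obtain ⟨p, hp, h⟩ := Finset.mem_image.mp h
    exact hf1 p hp h
  rw [← hcard, NumberField.classNumber]
  exact Finset.card_le_univ _
end

section
/- For every real number C there exists a natural number N₀ such that for every positive integer n with d = n^2 + 1 squarefree and with at least N₀ distinct odd prime divisors, the class number of the real quadratic field Q(√d) exceeds C. In other words, h(n^2+1) tends to infinity as the number of distinct odd prime factors of n tends to infinity (over n with n^2+1 squarefree). -/
open NumberField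

/-- Descent: a small value of `a² - (n²+1) b²` is a square up to sign. -/
lemma small_norm_sq (n : ℤ) (hn : 0 < n) (k : ℕ) : ∀ a b M : ℤ, b.natAbs = k → |M| < 2 * n →
    a ^ 2 - (n ^ 2 + 1) * b ^ 2 = M → ∃ c : ℤ, c ^ 2 = |M| := by
  induction k using Nat.strong_induction_on with
  | _ k ih =>
  intro a b M hk hM h
  by_cases hb : b = 0
  · subst hb
    refine ⟨a, ?_⟩
    have : a ^ 2 = M := by linarith
    rw [← this, abs_of_nonneg (sq_nonneg a)]
  have hbpos : 0 < |b| := abs_pos.mpr hb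
  have h' : |a| ^ 2 - (n ^ 2 + 1) * |b| ^ 2 = M := by simpa [sq_abs] using h
  have ha := abs_nonneg a
  have hBk : |b| = (k : ℤ) := by rw [← hk]; exact Int.abs_eq_natAbs b
  generalize hA : |a| = A at *
  generalize hB : |b| = B at *
  obtain ⟨hM1, hM2⟩ := abs_lt.mp hM
  have hBB : 1 ≤ B ^ 2 := by nlinarith
  have h1 : A < (n + 1) * B := by
    by_contra! hc
    have : ((n + 1) * B) ^ 2 ≤ A ^ 2 := by
      apply pow_le_pow_left₀ (by positivity) hc
    nlinarith
  have h2 : (n - 1) * B < A := by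
    by_contra! hc
    have : A ^ 2 ≤ ((n - 1) * B) ^ 2 := by
      apply pow_le_pow_left₀ ha hc
    nlinarith
  have hlt : (A - B * n).natAbs < k := by
    have : |A - B * n| < B := by
      rw [abs_lt]; constructor <;> nlinarith
    rw [Int.abs_eq_natAbs] at this
    omega
  obtain ⟨c, hc⟩ := ih _ hlt (B * (n ^ 2 + 1) - A * n) (A - B * n) (-M) rfl
    (by rwa [abs_neg]) (by rw [← h']; ring)
  exact ⟨c, by rwa [abs_neg] at hc⟩

lemma rat_int_of_sq (d : ℕ) (hd : Squarefree d) (v : ℚ) (m : ℤ) (h : (d : ℚ) * v ^ 2 = m) :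
    ∃ b : ℤ, v = b := by
  have hden : (v.den : ℚ) ≠ 0 := by exact_mod_cast v.den_nz
  have h1 : (d : ℚ) * v.num ^ 2 = m * v.den ^ 2 := by
    rw [← h]
    have : v * v.den = v.num := Rat.mul_den_eq_num v
    rw [← this]; ring
  have h2 : (d : ℤ) * v.num ^ 2 = m * v.den ^ 2 := by exact_mod_cast h1
  have h3 : ((v.den : ℤ)) ^ 2 ∣ (d : ℤ) * v.num ^ 2 := ⟨m, by rw [h2]; ring⟩
  have hcop : IsCoprime ((v.den : ℤ) ^ 2) (v.num ^ 2) := by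
    apply IsCoprime.pow
    rw [Int.isCoprime_iff_gcd_eq_one]
    have := v.reduced
    rw [Nat.coprime_comm] at this
    simpa [Int.gcd] using this
  have h4 : ((v.den : ℤ)) ^ 2 ∣ (d : ℤ) := hcop.dvd_of_dvd_mul_right h3
  have h5 : v.den * v.den ∣ d := by
    rw [← pow_two]; exact_mod_cast h4
  have h6 : v.den = 1 := Nat.isUnit_iff.mp (hd _ h5)
  exact ⟨v.num, by rw [← Rat.mul_den_eq_num v, h6]; simp⟩

section field
variable {K : Type} [Field K] [NumberField K]

lemma coords (hK : Module.finrank ℚ K = 2) (d : ℕ) (hd : ¬ IsSquare d) (α : K)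
    (hα : α ^ 2 = (d : K)) (x : K) : ∃ u v : ℚ, x = (u : K) + v * α ∧
      Algebra.trace ℚ K x = 2 * u ∧ Algebra.norm ℚ x = u ^ 2 - d * v ^ 2 := by
  have hli : LinearIndependent ℚ ![(1 : K), α] := by
    rw [LinearIndependent.pair_iff]
    intro s t hst
    have hst' : (s : K) + t * α = 0 := by
      simpa [Algebra.smul_def] using hst
    have ht : t = 0 := by
      by_contra ht
      apply hd
      have htK : (t : K) ≠ 0 := by exact_mod_cast ht
      have h1 : (s : K) ^ 2 = t ^ 2 * d := by
        rw [← hα]; linear_combination (s - t * α) * hst'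
      have h2 : s ^ 2 = t ^ 2 * d := by exact_mod_cast h1
      rw [← Rat.isSquare_natCast_iff]
      refine ⟨s / t, ?_⟩
      field_simp
      linarith
    subst ht
    refine ⟨?_, rfl⟩
    simpa using hst'
  let b := basisOfLinearIndependentOfCardEqFinrank hli (by simp [hK])
  have hb0 : b 0 = 1 := by simp [b]
  have hb1 : b 1 = α := by simp [b]
  refine ⟨b.repr x 0, b.repr x 1, ?_⟩
  have hx : x = ((b.repr x 0 : ℚ) : K) + (b.repr x 1 : ℚ) * α := by
    conv_lhs => rw [← b.sum_repr x]
    simp [Fin.sum_univ_two, hb0, hb1, Algebra.smul_def]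
  generalize b.repr x 0 = u at *
  generalize b.repr x 1 = v at *
  have hm : Algebra.leftMulMatrix b x = !![u, d * v; v, u] := by
    have e0 : x * b 0 = u • b 0 + v • b 1 := by
      rw [hb0, hb1, hx]; simp [Algebra.smul_def]
    have e1 : x * b 1 = (d * v) • b 0 + u • b 1 := by
      rw [hb0, hb1, hx]; simp [Algebra.smul_def]
      linear_combination (v : K) * hα
    ext i j
    rw [Algebra.leftMulMatrix_eq_repr_mul]
    fin_cases j
    · simp only [Fin.zero_eta, e0]
      fin_cases i <;> simp
    · simp only [Fin.mk_one, e1]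
      fin_cases i <;> simp
  refine ⟨hx, ?_, ?_⟩
  · rw [Algebra.trace_eq_matrix_trace b, hm, Matrix.trace_fin_two]; simp; ring
  · rw [Algebra.norm_eq_matrix_det b, hm, Matrix.det_fin_two]; simp; ring

lemma int_coords (hK : Module.finrank ℚ K = 2) (d : ℕ) (hd : ¬ IsSquare d)
    (hsf : Squarefree d) (α : K)
    (hα : α ^ 2 = (d : K)) (x : 𝓞 K) : ∃ a b : ℤ,
      a ^ 2 - d * b ^ 2 = 4 * Algebra.norm ℤ x := by
  obtain ⟨u, v, hx, ht, hN⟩ := coords hK d hd α hα (x : K)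
  rw [← Algebra.coe_trace_int] at ht
  rw [← Algebra.coe_norm_int] at hN
  generalize Algebra.norm ℤ x = N at *
  generalize Algebra.trace ℤ (𝓞 K) x = a at *
  obtain ⟨b, hb⟩ := rat_int_of_sq d hsf (2 * v) (a ^ 2 - 4 * N) (by push_cast; rw [ht, hN]; ring)
  refine ⟨a, b, ?_⟩
  have : (a : ℚ) ^ 2 - d * b ^ 2 = 4 * N := by rw [← hb, ht, hN]; ring
  exact_mod_cast this

/-- the ideal `(p, β - 1)`. -/
noncomputable def PI (p : ℕ) (β : 𝓞 K) : Ideal (𝓞 K) := Ideal.span {(p : 𝓞 K), β - 1}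

lemma PI_mul (n p : ℕ) (hp : p.Prime) (hp2 : p ≠ 2) (hpn : p ∣ n) (β : 𝓞 K)
    (hβ : β ^ 2 = ((n ^ 2 + 1 : ℕ) : 𝓞 K)) : PI p β * PI p (-β) = Ideal.span {(p : 𝓞 K)} := by
  unfold PI
  rw [Ideal.span_pair_mul_span_pair]
  obtain ⟨k, rfl⟩ := hpn
  push_cast at hβ
  apply le_antisymm
  · rw [Ideal.span_le]
    intro y hy
    simp only [Set.mem_insert_iff, Set.mem_singleton_iff] at hy
    rw [SetLike.mem_coe, Ideal.mem_span_singleton]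
    rcases hy with rfl | rfl | rfl | rfl
    · exact ⟨_, rfl⟩
    · exact ⟨_, rfl⟩
    · exact ⟨β - 1, by ring⟩
    · exact ⟨- p * k ^ 2, by linear_combination -hβ⟩
  · rw [Ideal.span_singleton_le_iff_mem]
    obtain ⟨m, hm⟩ := hp.odd_of_ne_two hp2
    have hm' : (p : 𝓞 K) = 2 * m + 1 := by exact_mod_cast congrArg (Nat.cast (R := 𝓞 K)) hm
    have e : (p : 𝓞 K) = (p : 𝓞 K) * p + m * ((p : 𝓞 K) * (-β - 1) + (β - 1) * p) := by
      linear_combination -(p : 𝓞 K) * hm'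
    have key : (p : 𝓞 K) * p + m * ((p : 𝓞 K) * (-β - 1) + (β - 1) * p) ∈ Ideal.span
        {(p : 𝓞 K) * p, (p : 𝓞 K) * (-β - 1), (β - 1) * p, (β - 1) * (-β - 1)} := by
      refine Ideal.add_mem _ (Ideal.subset_span (by simp)) (Ideal.mul_mem_left _ _ (Ideal.add_mem _
        (Ideal.subset_span (by simp)) (Ideal.subset_span (by simp))))
    rwa [← e] at key

lemma not_sq (n : ℕ) (hn : 0 < n) : ¬ IsSquare (n ^ 2 + 1) := by
  rintro ⟨r, hr⟩
  have h1 : n < r := by nlinarith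
  nlinarith

lemma PI_ne_top (hK : Module.finrank ℚ K = 2) (n p : ℕ) (hn : 0 < n)
    (hp : p.Prime) (hp2 : p ≠ 2) (hpn : p ∣ n) (β : 𝓞 K)
    (hβ : β ^ 2 = ((n ^ 2 + 1 : ℕ) : 𝓞 K)) : PI p β ≠ ⊤ := by
  intro h
  have hm := PI_mul n p hp hp2 hpn β hβ
  rw [h, Ideal.top_mul] at hm
  have : -β - 1 ∈ PI p (-β) := Ideal.subset_span (by simp)
  rw [hm, Ideal.mem_span_singleton] at this
  obtain ⟨z, hz⟩ := this
  have hβK : (β : K) ^ 2 = ((n ^ 2 + 1 : ℕ) : K) := by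
    have := congrArg (algebraMap (𝓞 K) K) hβ
    simpa using this
  have hz2 : (β : K) = -1 - p * (z : K) := by
    have := congrArg (algebraMap (𝓞 K) K) hz
    simp at this
    linear_combination -this
  have htβ : Algebra.trace ℚ K (β : K) = 0 := by
    obtain ⟨u, v, hx, ht, -⟩ := coords hK _ (not_sq n hn) (β : K) hβK (β : K)
    by_contra hne
    rw [ht] at hne
    have hu : u ≠ 0 := by intro h; simp [h] at hne
    have huK : (u : K) ≠ 0 := by exact_mod_cast hu
    -- `β = u / (1 - v)` would be rational
    have hv : (1 - v : ℚ) ≠ 0 := by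
      intro hv
      apply huK
      have : v = 1 := by linarith
      rw [this] at hx; simpa using hx
    have h1 : ((1 - v : ℚ) : K) ^ 2 * ((n ^ 2 + 1 : ℕ) : K) = (u : K) ^ 2 := by
      rw [← hβK]; push_cast
      linear_combination ((1 - v) * (β : K) + u) * hx
    have h2 : (1 - v) ^ 2 * ((n ^ 2 + 1 : ℕ) : ℚ) = u ^ 2 := by exact_mod_cast h1
    apply not_sq n hn
    rw [← Rat.isSquare_natCast_iff]
    refine ⟨u / (1 - v), ?_⟩
    field_simp
    linarith
  have h1 : Algebra.trace ℚ K ((p : ℚ) • (z : K)) = -2 := by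
    have : (p : ℚ) • (z : K) = -(algebraMap ℚ K 1) - β := by
      rw [hz2, Algebra.smul_def]; simp
    rw [this, map_sub, map_neg, Algebra.trace_algebraMap, htβ, hK]; simp
  rw [map_smul, ← Algebra.coe_trace_int, smul_eq_mul] at h1
  have h2 : (p : ℤ) * Algebra.trace ℤ (𝓞 K) z = -2 := by exact_mod_cast h1
  have h3 : (p : ℤ) ∣ 2 := by rw [← dvd_neg]; exact ⟨_, h2.symm⟩
  have h4 : p ∣ 2 := by exact_mod_cast h3
  exact hp2 ((Nat.prime_dvd_prime_iff_eq hp Nat.prime_two).mp h4)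

lemma absNorm_PI (hK : Module.finrank ℚ K = 2) (n p : ℕ) (hn : 0 < n)
    (hp : p.Prime) (hp2 : p ≠ 2) (hpn : p ∣ n) (β : 𝓞 K)
    (hβ : β ^ 2 = ((n ^ 2 + 1 : ℕ) : 𝓞 K)) : Ideal.absNorm (PI p β) = p := by
  have hm := congrArg Ideal.absNorm (PI_mul n p hp hp2 hpn β hβ)
  have h1 : Ideal.absNorm (PI p β) ≠ 1 := by
    rw [Ne, Ideal.absNorm_eq_one_iff]; exact PI_ne_top hK n p hn hp hp2 hpn β hβ
  have h2 : Ideal.absNorm (PI p (-β)) ≠ 1 := by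
    rw [Ne, Ideal.absNorm_eq_one_iff]
    exact PI_ne_top hK n p hn hp hp2 hpn (-β) (by rw [neg_sq, hβ])
  have h3 : Ideal.absNorm (Ideal.span {(p : 𝓞 K)}) = p ^ 2 := by
    rw [Ideal.absNorm_span_singleton, show (p : 𝓞 K) = algebraMap ℤ (𝓞 K) p by simp,
      Algebra.norm_algebraMap, NumberField.RingOfIntegers.rank, hK]
    simp [Int.natAbs_pow]
  rw [map_mul, h3] at hm
  exact ((hp.mul_eq_prime_sq_iff h1 h2).mp hm).1

end field

/-- The class number of `ℚ(√(n^2+1))` tends to infinity as the number of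
distinct odd prime factors of `n` tends to infinity (over `n` with `n^2 + 1`
squarefree). -/
theorem class_number_tendsto_infinity :
    ∀ C : ℝ, ∃ N₀ : ℕ, ∀ n : ℕ, 0 < n → Squarefree (n ^ 2 + 1) →
      N₀ ≤ (n.primeFactors.filter fun p => p ≠ 2).card →
      ∀ (K : Type) [Field K] [NumberField K], Module.finrank ℚ K = 2 →
      ∀ α : K, α ^ 2 = ((n ^ 2 + 1 : ℕ) : K) →
      C < (NumberField.classNumber K : ℝ) := by
  intro C
  obtain ⟨N, hN⟩ := exists_nat_gt C
  refine ⟨max N 3, ?_⟩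
  intro n hn hsf hcard K _ _ hK α hα
  set S := n.primeFactors.filter fun p => p ≠ 2 with hS
  have hSp : ∀ p ∈ S, p.Prime ∧ p ∣ n ∧ p ≠ 2 := by
    intro p hp
    rw [hS, Finset.mem_filter, Nat.mem_primeFactors] at hp
    exact ⟨hp.1.1, hp.1.2.1, hp.2⟩
  have hint : IsIntegral ℤ α := by
    apply IsIntegral.of_pow (n := 2) (by norm_num)
    rw [hα]; exact isIntegral_natCast _
  let β : 𝓞 K := ⟨α, hint⟩
  have hβ : β ^ 2 = ((n ^ 2 + 1 : ℕ) : 𝓞 K) := by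
    apply RingOfIntegers.ext
    change algebraMap (𝓞 K) K (β ^ 2) = algebraMap (𝓞 K) K ((n ^ 2 + 1 : ℕ) : 𝓞 K)
    rw [map_pow, map_natCast]
    exact hα
  have hβ' : (-β) ^ 2 = ((n ^ 2 + 1 : ℕ) : 𝓞 K) := by rw [neg_sq, hβ]
  have hne : ∀ p ∈ S, ∀ γ : 𝓞 K, PI p γ ∈ nonZeroDivisors (Ideal (𝓞 K)) := by
    intro p hp γ
    rw [mem_nonZeroDivisors_iff_ne_zero]
    intro h
    have : (p : 𝓞 K) ∈ PI p γ := Ideal.subset_span (by simp)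
    rw [h] at this
    have : (p : 𝓞 K) = 0 := by simpa using this
    exact (hSp p hp).1.ne_zero (by exact_mod_cast this)
  let f : S → ClassGroup (𝓞 K) := fun p => ClassGroup.mk0 ⟨PI p.1 β, hne p.1 p.2 β⟩
  have hf : Function.Injective f := by
    rintro ⟨p, hp⟩ ⟨q, hq⟩ hpq
    by_contra hne'
    have hpq' : p ≠ q := fun h => hne' (Subtype.ext h)
    obtain ⟨hp1, hpn, hp2⟩ := hSp p hp
    obtain ⟨hq1, hqn, hq2⟩ := hSp q hq
    -- the product is principal
    have h1 : ClassGroup.mk0 ⟨PI q β, hne q hq β⟩ * ClassGroup.mk0 ⟨PI q (-β), hne q hq (-β)⟩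
        = 1 := by
      rw [← map_mul]
      refine (ClassGroup.mk0_eq_one_iff (I := PI q β * PI q (-β))
        (mul_mem (hne q hq β) (hne q hq (-β)))).mpr ?_
      rw [PI_mul n q hq1 hq2 hqn β hβ]
      exact ⟨⟨_, rfl⟩⟩
    have h2 : (PI p β * PI q (-β)).IsPrincipal := by
      refine (ClassGroup.mk0_eq_one_iff (mul_mem (hne p hp β) (hne q hq (-β)))).mp ?_
      have h3 : ClassGroup.mk0 ⟨PI p β, hne p hp β⟩ = ClassGroup.mk0 ⟨PI q β, hne q hq β⟩ := hpq
      rw [← h3, ← map_mul] at h1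
      exact h1
    obtain ⟨⟨g, hg⟩⟩ := h2
    have hg' : PI p β * PI q (-β) = Ideal.span {g} := hg
    have hnorm := congrArg Ideal.absNorm hg'
    rw [map_mul, absNorm_PI hK n p hn hp1 hp2 hpn β hβ, absNorm_PI hK n q hn hq1 hq2 hqn _ hβ',
      Ideal.absNorm_span_singleton] at hnorm
    obtain ⟨a, b, hab⟩ := int_coords hK _ (not_sq n hn) hsf α hα g
    -- a third prime
    obtain ⟨r, hr, hrp, hrq⟩ : ∃ r ∈ S, r ≠ p ∧ r ≠ q := by
      by_contra! hc
      have : S ⊆ {p, q} := by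
        intro r hr
        by_cases hrp : r = p
        · simp [hrp]
        · simp [hc r hr hrp]
      have h4 := Finset.card_le_card this
      have h5 := Finset.card_le_two (a := p) (b := q)
      have h6 := le_trans (le_max_right N 3) hcard
      omega
    obtain ⟨hr1, hrn, hr2⟩ := hSp r hr
    have hdvd : p * q * r ∣ n := by
      apply Nat.Coprime.mul_dvd_of_dvd_of_dvd
      · exact Nat.Coprime.mul_left ((Nat.coprime_primes hp1 hr1).mpr hrp.symm)
          ((Nat.coprime_primes hq1 hr1).mpr hrq.symm)
      · exact Nat.Coprime.mul_dvd_of_dvd_of_dvd ((Nat.coprime_primes hp1 hq1).mpr hpq') hpn hqn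
      · exact hrn
    have hle := Nat.le_of_dvd hn hdvd
    have hr3 : 3 ≤ r := by have := hr1.two_le; omega
    have hpos : 0 < p * q := Nat.mul_pos hp1.pos hq1.pos
    have hlt : 2 * (p * q) < n := by nlinarith
    have habs : |4 * Algebra.norm ℤ g| = 4 * ((p * q : ℕ) : ℤ) := by
      rw [abs_mul, Int.abs_eq_natAbs (Algebra.norm ℤ g), ← hnorm]; rfl
    obtain ⟨c, hc⟩ := small_norm_sq n (by exact_mod_cast hn) _ a b _ rfl
      (by rw [habs]; omega) (by rw [← hab]; push_cast; ring)
    rw [habs] at hc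
    have hc' : c.natAbs ^ 2 = 4 * (p * q) := by
      zify; rw [sq_abs, hc]; push_cast; ring
    have hpc : p ∣ c.natAbs := hp1.dvd_of_dvd_pow (n := 2) (by rw [hc']; exact ⟨4 * q, by ring⟩)
    obtain ⟨e, he⟩ := hpc
    rw [he] at hc'
    have h7 : p * e ^ 2 = 4 * q := by
      apply Nat.eq_of_mul_eq_mul_left hp1.pos
      linarith
    have h8 : p ∣ 2 ^ 2 * q := ⟨e ^ 2, by linarith⟩
    rcases hp1.dvd_mul.mp h8 with h9 | h9
    · exact hp2 ((Nat.prime_dvd_prime_iff_eq hp1 Nat.prime_two).mp (hp1.dvd_of_dvd_pow h9))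
    · exact hpq' ((Nat.prime_dvd_prime_iff_eq hp1 hq1).mp h9)
  have hle := Fintype.card_le_of_injective f hf
  rw [Fintype.card_coe] at hle
  have h10 : N ≤ NumberField.classNumber K := (le_max_left N 3).trans (hcard.trans hle)
  exact lt_of_lt_of_le hN (by exact_mod_cast h10)
end

section
/- Let p be an odd prime and let m, t ≥ 2 be integers. Set n = 2^m · p^t and suppose d = n^2 + 1 is squarefree with d ≡ 1 (mod 8). If the class number of Q(√d) equals 4, then the ideal class group of Q(√d) is isomorphic to Z/4Z (i.e., it is cyclic of order 4). -/
/-- Descent along the unit `n + √d`: integer solutions of `x² - (n²+1) y² = ±16` are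
divisible by `4`. -/
theorem pell_descent (n : ℤ) (hn : 9 ≤ n) (e : ℤ) (he : e = 16 ∨ e = -16) :
    ∀ (B : ℕ) (e : ℤ), (e = 16 ∨ e = -16) → ∀ (x y : ℤ), y.natAbs ≤ B → 0 ≤ x → 0 ≤ y →
      x ^ 2 - (n ^ 2 + 1) * y ^ 2 = e → 4 ∣ x ∧ 4 ∣ y := by
  intro B
  induction B with
  | zero =>
    intro e he x y hB hx hy h
    have hy0 : y = 0 := by omega
    subst hy0
    refine ⟨?_, by simp⟩
    have h1 : x ^ 2 = e := by linarith
    rcases he with rfl | rfl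
    · have : x = 4 := by nlinarith
      subst this; norm_num
    · nlinarith
  | succ B ih =>
    intro e he x y hB hx hy h
    rcases Nat.lt_or_ge y.natAbs (B + 1) with hlt | hge
    · exact ih e he x y (by omega) hx hy h
    have hy1 : 1 ≤ y := by omega
    have hy2 : 1 ≤ y ^ 2 := by nlinarith
    have hny : 9 * y ^ 2 ≤ n * y ^ 2 := by nlinarith
    have hu : x < (n + 1) * y := by
      by_contra hc
      push Not at hc
      have : ((n + 1) * y) ^ 2 ≤ x ^ 2 := by
        apply pow_le_pow_left₀ (by positivity) hc
      rcases he with rfl | rfl <;> nlinarith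
    have hl : (n - 1) * y < x := by
      by_contra hc
      push Not at hc
      have : x ^ 2 ≤ ((n - 1) * y) ^ 2 := by
        apply pow_le_pow_left₀ hx hc
      rcases he with rfl | rfl <;> nlinarith
    have key : (((n ^ 2 + 1) * y - n * x)) ^ 2 - (n ^ 2 + 1) * (x - n * y) ^ 2 = -e := by
      rw [← h]; ring
    have key' : |((n ^ 2 + 1) * y - n * x)| ^ 2 - (n ^ 2 + 1) * |x - n * y| ^ 2 = -e := by
      rw [sq_abs, sq_abs, key]
    have hab : |x - n * y| < y := by
      rw [abs_lt]; constructor <;> linarith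
    obtain ⟨h1, h2⟩ := ih (-e) (by omega) _ _ (by
      have h0 := abs_nonneg (x - n * y)
      clear key' key
      generalize |x - n * y| = w at *
      omega) (abs_nonneg _) (abs_nonneg _) key'
    rw [dvd_abs] at h1 h2
    have hx' : x = n * ((n ^ 2 + 1) * y - n * x) + (n ^ 2 + 1) * (x - n * y) := by ring
    have hy' : y = ((n ^ 2 + 1) * y - n * x) + n * (x - n * y) := by ring
    exact ⟨by rw [hx']; exact dvd_add (Dvd.dvd.mul_left h1 _) (Dvd.dvd.mul_left h2 _),
      by rw [hy']; exact dvd_add h1 (Dvd.dvd.mul_left h2 _)⟩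

theorem pell_four_dvd (n : ℤ) (hn : 9 ≤ n) (e : ℤ) (he : e = 16 ∨ e = -16) (x y : ℤ)
    (h : x ^ 2 - (n ^ 2 + 1) * y ^ 2 = e) : 4 ∣ x ∧ 4 ∣ y := by
  have := pell_descent n hn e he |y|.natAbs e he |x| |y| le_rfl (abs_nonneg _) (abs_nonneg _)
    (by rw [sq_abs, sq_abs, h])
  simpa [dvd_abs] using this

/-- If `d` is squarefree and `d r²` is an integer then so is the rational `r`. -/
theorem rat_int_of_sq_s4 (d : ℕ) (hsf : Squarefree d) (r : ℚ) (M : ℤ) (h : d * r ^ 2 = M) :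
    ∃ s : ℤ, r = s := by
  have hden : (r.den : ℚ) ≠ 0 := by exact_mod_cast r.den_nz
  have h1 : (d : ℤ) * r.num ^ 2 = M * (r.den : ℤ) ^ 2 := by
    have h2 : (d : ℚ) * r.num ^ 2 = M * (r.den : ℚ) ^ 2 := by
      rw [← h]
      nth_rewrite 2 [← Rat.num_div_den r]
      field_simp
    exact_mod_cast h2
  have hdv : (r.den : ℤ) ^ 2 ∣ (d : ℤ) * r.num ^ 2 := ⟨M, by rw [h1]; ring⟩
  have hco : IsCoprime ((r.den : ℤ) ^ 2) (r.num ^ 2) := by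
    apply IsCoprime.pow
    have := r.reduced
    rw [Int.isCoprime_iff_gcd_eq_one, Int.gcd_comm]
    simpa [Int.gcd, Nat.Coprime] using this
  have h3 : (r.den : ℤ) ^ 2 ∣ (d : ℤ) := hco.dvd_of_dvd_mul_right hdv
  have h4 : r.den * r.den ∣ d := by
    rw [← sq]; exact_mod_cast h3
  have h5 : r.den = 1 := Nat.isUnit_iff.mp (hsf _ h4)
  exact ⟨r.num, ((Rat.den_eq_one_iff r).mp h5).symm⟩

section
variable {K : Type} [Field K] [NumberField K]

theorem quad_coords (d : ℕ) (hns : ∀ r : ℚ, r ^ 2 ≠ d) (α : K) (hα : α ^ 2 = (d : K)) (a b : ℚ)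
    (h : (a : K) + b * α = 0) : a = 0 ∧ b = 0 := by
  have hb : b = 0 := by
    by_contra hb
    have hb' : (b : K) ≠ 0 := by exact_mod_cast hb
    have : α = ((-a / b : ℚ) : K) := by
      push_cast
      field_simp
      linear_combination h
    rw [this] at hα
    exact hns _ (by exact_mod_cast hα)
  subst hb
  refine ⟨?_, rfl⟩
  simpa using h

theorem quad_norm_trace (d : ℕ) (hns : ∀ r : ℚ, r ^ 2 ≠ d) (hdeg : Module.finrank ℚ K = 2)
    (α : K) (hα : α ^ 2 = (d : K)) (z : K) :
    ∃ a b : ℚ, z = a + b * α ∧ Algebra.trace ℚ K z = 2 * a ∧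
      Algebra.norm ℚ z = a ^ 2 - d * b ^ 2 := by
  have hli : LinearIndependent ℚ ![(1 : K), α] := by
    rw [LinearIndependent.pair_iff]
    intro s t h
    apply quad_coords d hns α hα
    simpa [Algebra.smul_def] using h
  let B := basisOfLinearIndependentOfCardEqFinrank hli (by simp [hdeg])
  have hB0 : B 0 = 1 := by simp [B]
  have hB1 : B 1 = α := by simp [B]
  have hz := B.sum_repr z
  rw [Fin.sum_univ_two, hB0, hB1] at hz
  set a := B.repr z 0
  set b := B.repr z 1
  have hz' : z = a + b * α := by
    rw [← hz]; simp [Algebra.smul_def]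
  have hM : Algebra.leftMulMatrix B z = !![a, d * b; b, a] := by
    have e0 : z * B 0 = a • B 0 + b • B 1 := by
      rw [hB0, hB1, hz']; simp [Algebra.smul_def]
    have e1 : z * B 1 = (d * b) • B 0 + a • B 1 := by
      rw [hB0, hB1, hz']; simp [Algebra.smul_def]
      linear_combination (b : K) * hα
    ext i j
    rw [Algebra.leftMulMatrix_eq_repr_mul]
    fin_cases j
    · simp only [Fin.zero_eta, e0]
      fin_cases i <;> simp
    · simp only [Fin.mk_one, e1]
      fin_cases i <;> simp
  refine ⟨a, b, hz', ?_, ?_⟩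
  · rw [Algebra.trace_eq_matrix_trace B, hM]; simp [Matrix.trace_fin_two]; ring
  · rw [Algebra.norm_eq_matrix_det B, hM, Matrix.det_fin_two]; simp; ring

theorem quad_int (d : ℕ) (hns : ∀ r : ℚ, r ^ 2 ≠ d) (hsf : Squarefree d)
    (hdeg : Module.finrank ℚ K = 2)
    (α : K) (hα : α ^ 2 = (d : K)) (z : NumberField.RingOfIntegers K) :
    ∃ x y : ℤ, 2 * (z : K) = x + y * α ∧ x ^ 2 - d * y ^ 2 = 4 * Algebra.norm ℤ z := by
  obtain ⟨a, b, hz, htr, hno⟩ := quad_norm_trace d hns hdeg α hα (z : K)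
  have hint : IsIntegral ℤ (Algebra.trace ℚ K (z : K)) :=
    Algebra.isIntegral_trace z.isIntegral_coe
  obtain ⟨x, hx⟩ := IsIntegrallyClosed.isIntegral_iff.mp hint
  have hx' : (x : ℚ) = 2 * a := by rw [← htr, ← hx]; simp
  rw [← Algebra.coe_norm_int] at hno
  obtain ⟨y, hy⟩ := rat_int_of_sq_s4 d hsf (2 * b) (x ^ 2 - 4 * Algebra.norm ℤ z) (by
    push_cast
    rw [hx', hno]; ring)
  refine ⟨x, y, ?_, ?_⟩
  · have h1 : (x : K) = 2 * (a : K) := by exact_mod_cast congrArg (Rat.cast : ℚ → K) hx'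
    have h2 : (y : K) = 2 * (b : K) := by exact_mod_cast congrArg (Rat.cast : ℚ → K) hy.symm
    rw [h1, h2, hz]; ring
  · have : (x : ℚ) ^ 2 - d * (y : ℚ) ^ 2 = 4 * (Algebra.norm ℤ z : ℚ) := by
      rw [hx', ← hy, hno]; ring
    exact_mod_cast this

end

open NumberField in
theorem exists_sq_ne_one (n j : ℕ) (hn : 9 ≤ n) (hj : n = 4 * j) (d : ℕ) (hd : d = n ^ 2 + 1)
    (hsf : Squarefree d)
    (K : Type) [Field K] [NumberField K]
    (hdeg : Module.finrank ℚ K = 2) (α : K) (hα : α ^ 2 = (d : K)) :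
    ∃ c : ClassGroup (𝓞 K), c ^ 2 ≠ 1 := by
  have hns : ∀ r : ℚ, r ^ 2 ≠ d := by
    intro r hr
    obtain ⟨s, rfl⟩ := rat_int_of_sq_s4 1 squarefree_one r d (by rw [hr]; simp)
    have h1 : s ^ 2 = (n : ℤ) ^ 2 + 1 := by
      have : (s : ℚ) ^ 2 = (n : ℚ) ^ 2 + 1 := by rw [hr, hd]; push_cast; ring
      exact_mod_cast this
    have h2 : |s| ^ 2 = (n : ℤ) ^ 2 + 1 := by rw [sq_abs, h1]
    have h3 : (n : ℤ) < |s| := by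
      apply lt_of_pow_lt_pow_left₀ 2 (abs_nonneg _); omega
    nlinarith
  have hdj : (d : K) = 16 * (j : K) ^ 2 + 1 := by
    rw [hd, hj]; push_cast; ring
  have hωint : IsIntegral ℤ ((1 + α) / 2) := by
    refine ⟨Polynomial.X ^ 2 - (Polynomial.X + Polynomial.C (4 * (j : ℤ) ^ 2)), ?_, ?_⟩
    · apply Polynomial.monic_X_pow_sub
      compute_degree!
    · simp only [Polynomial.eval₂_sub, Polynomial.eval₂_add, Polynomial.eval₂_X_pow,
        Polynomial.eval₂_X, Polynomial.eval₂_C]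
      simp
      rw [hdj] at hα
      linear_combination (1 / 4 : K) * hα
  let ω : 𝓞 K := ⟨(1 + α) / 2, hωint⟩
  have hω : (ω : K) = (1 + α) / 2 := rfl
  have hω' : algebraMap (𝓞 K) K ω = (1 + α) / 2 := rfl
  have hω2 : ω ^ 2 = ω + 4 * (j : 𝓞 K) ^ 2 := by
    apply FaithfulSMul.algebraMap_injective (𝓞 K) K
    simp only [map_mul, map_add, map_sub, map_pow, map_ofNat, map_natCast, map_intCast, map_one]
    rw [hω']
    rw [hdj] at hα
    linear_combination (1 / 4 : K) * hα
  have hnd : ¬ (2 : 𝓞 K) ∣ ω := by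
    rintro ⟨γ, hγ⟩
    obtain ⟨x, y, h1, -⟩ := quad_int d hns hsf hdeg α hα γ
    have h2 : (ω : K) = x + y * α := by
      rw [← h1, hγ]; push_cast; rfl
    rw [hω] at h2
    have h3 := (quad_coords d hns α hα (1 / 2 - x) (1 / 2 - y) (by
      push_cast; linear_combination h2)).1
    have h4 : (1 : ℚ) = 2 * x := by linarith
    have h5 : (1 : ℤ) = 2 * x := by exact_mod_cast h4
    omega
  have hnd' : ¬ (2 : 𝓞 K) ∣ 1 - ω := by
    rintro ⟨γ, hγ⟩
    obtain ⟨x, y, h1, -⟩ := quad_int d hns hsf hdeg α hα γ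
    have h2 : 1 - (ω : K) = x + y * α := by
      rw [← h1]
      have := congrArg (fun z : 𝓞 K => (z : K)) hγ
      push_cast at this
      exact this
    rw [hω] at h2
    have h3 := (quad_coords d hns α hα (1 / 2 - x) (- 1 / 2 - y) (by
      push_cast; linear_combination h2)).1
    have h4 : (1 : ℚ) = 2 * x := by linarith
    have h5 : (1 : ℤ) = 2 * x := by exact_mod_cast h4
    omega
  let P : Ideal (𝓞 K) := Ideal.span {2, ω}
  let Q : Ideal (𝓞 K) := Ideal.span {2, 1 - ω}
  have h2P : (2 : 𝓞 K) ∈ P := Ideal.subset_span (by simp)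
  have hωP : ω ∈ P := Ideal.subset_span (by simp)
  have h2Q : (2 : 𝓞 K) ∈ Q := Ideal.subset_span (by simp)
  have hωQ : 1 - ω ∈ Q := Ideal.subset_span (by simp)
  have hPQ : P * Q = Ideal.span {2} := by
    apply le_antisymm
    · rw [Ideal.span_pair_mul_span_pair, Ideal.span_le]
      intro z hz
      simp only [Set.mem_insert_iff, Set.mem_singleton_iff] at hz
      rw [SetLike.mem_coe, Ideal.mem_span_singleton]
      rcases hz with rfl | rfl | rfl | rfl
      · exact dvd_mul_right _ _
      · exact dvd_mul_right _ _
      · exact dvd_mul_left _ _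
      · exact ⟨-2 * (j : 𝓞 K) ^ 2, by linear_combination -hω2⟩
    · rw [Ideal.span_singleton_le_iff_mem]
      have h1 := Ideal.mul_mem_mul hωP h2Q
      have h2 := Ideal.mul_mem_mul h2P hωQ
      have h3 := add_mem h1 h2
      have : ω * 2 + 2 * (1 - ω) = 2 := by ring
      rwa [this] at h3
  have hPtop : P ≠ ⊤ := by
    intro h
    rw [h, Ideal.top_mul] at hPQ
    rw [hPQ, Ideal.mem_span_singleton] at hωQ
    exact hnd' hωQ
  have hQtop : Q ≠ ⊤ := by
    intro h
    rw [h, Ideal.mul_top] at hPQ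
    rw [hPQ, Ideal.mem_span_singleton] at hωP
    exact hnd hωP
  have hnorm2 : Algebra.norm ℤ (2 : 𝓞 K) = 4 := by
    have h := Algebra.norm_algebraMap (S := 𝓞 K) (2 : ℤ)
    rw [RingOfIntegers.rank, hdeg] at h
    simpa using h
  have hPn : Ideal.absNorm P = 2 := by
    have h1 : Ideal.absNorm P * Ideal.absNorm Q = 4 := by
      rw [← map_mul, hPQ, Ideal.absNorm_span_singleton, hnorm2]; rfl
    have h2 : Ideal.absNorm P ≠ 1 := fun h => hPtop (Ideal.absNorm_eq_one_iff.mp h)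
    have h3 : Ideal.absNorm Q ≠ 1 := fun h => hQtop (Ideal.absNorm_eq_one_iff.mp h)
    generalize Ideal.absNorm P = a at *
    generalize Ideal.absNorm Q = b at *
    have ha : a ≤ 4 := Nat.le_of_dvd (by norm_num) ⟨b, h1.symm⟩
    interval_cases a <;> omega
  have hP0 : P ∈ nonZeroDivisors (Ideal (𝓞 K)) := by
    rw [mem_nonZeroDivisors_iff_ne_zero]
    intro h
    rw [h] at hPn
    simp at hPn
  refine ⟨ClassGroup.mk0 ⟨P, hP0⟩, ?_⟩
  rw [← map_pow]
  intro hc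
  rw [ClassGroup.mk0_eq_one_iff] at hc
  obtain ⟨β, hβ⟩ := hc.principal
  have hβ' : P ^ 2 = Ideal.span {β} := hβ
  have hNβ : (Algebra.norm ℤ β).natAbs = 4 := by
    rw [← Ideal.absNorm_span_singleton, ← hβ', map_pow, hPn]; rfl
  obtain ⟨x, y, hxy, hN⟩ := quad_int d hns hsf hdeg α hα β
  obtain ⟨⟨u, rfl⟩, ⟨v, rfl⟩⟩ := pell_four_dvd n (by exact_mod_cast hn) (4 * Algebra.norm ℤ β)
    (by omega) x y (by rw [← hN, hd]; push_cast; ring)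
  have hβ2 : (2 : 𝓞 K) ∣ β := by
    refine ⟨u + v * (2 * ω - 1), ?_⟩
    apply FaithfulSMul.algebraMap_injective (𝓞 K) K
    simp only [map_mul, map_add, map_sub, map_pow, map_ofNat, map_natCast, map_intCast, map_one]
    rw [hω']
    push_cast at hxy
    change 2 * algebraMap (𝓞 K) K β = _ at hxy
    linear_combination (1 / 2 : K) * hxy
  have hmem : ω ^ 2 ∈ P ^ 2 := Ideal.pow_mem_pow hωP 2
  rw [hβ', Ideal.mem_span_singleton] at hmem
  have h1 := hβ2.trans hmem
  rw [hω2] at h1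
  exact hnd ((dvd_add_left ⟨2 * (j : 𝓞 K) ^ 2, by ring⟩).mp h1)

/-- If `n = 2^m * p^t` with `p` an odd prime and `m, t ≥ 2`, `d = n^2 + 1` is
squarefree with `d ≡ 1 (mod 8)`, and the class number of `ℚ(√d)` is `4`, then
the class group of `ℚ(√d)` is cyclic of order `4`. -/
theorem class_group_cyclic_of_two_pow_mul_prime_pow
    (p : ℕ) (hp : p.Prime) (hodd : p ≠ 2) (m t : ℕ) (hm : 2 ≤ m) (ht : 2 ≤ t)
    (n : ℕ) (hn : n = 2 ^ m * p ^ t) (d : ℕ) (hd : d = n ^ 2 + 1)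
    (hsf : Squarefree d) (hmod : d % 8 = 1)
    (K : Type) [Field K] [NumberField K]
    (hdeg : Module.finrank ℚ K = 2) (α : K) (hα : α ^ 2 = (d : K))
    (hcl : NumberField.classNumber K = 4) :
    Nonempty (ClassGroup (NumberField.RingOfIntegers K) ≃* Multiplicative (ZMod 4)) := by
  have h2m : 2 ^ 2 ≤ 2 ^ m := Nat.pow_le_pow_right (by norm_num) hm
  have hpt : p ^ 2 ≤ p ^ t := Nat.pow_le_pow_right hp.pos ht
  have hp3 : 2 ≤ p := hp.two_le
  have hp4 : 2 ^ 2 ≤ p ^ 2 := Nat.pow_le_pow_left hp3 2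
  have hn9 : 9 ≤ n := by
    rw [hn]; nlinarith
  obtain ⟨j, hj⟩ : 4 ∣ n := by
    rw [hn]; exact Dvd.dvd.mul_right (pow_dvd_pow 2 hm) _
  obtain ⟨c, hc⟩ := exists_sq_ne_one n j hn9 hj d hd hsf K hdeg α hα
  have hcard : Nat.card (ClassGroup (NumberField.RingOfIntegers K)) = 4 := by
    rw [Nat.card_eq_fintype_card]; exact hcl
  have hord : orderOf c = 2 ^ (1 + 1) := by
    have : Fact (Nat.Prime 2) := ⟨Nat.prime_two⟩
    apply orderOf_eq_prime_pow
    · simpa using hc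
    · have := pow_card_eq_one' (x := c)
      rw [hcard] at this
      simpa using this
  have : IsCyclic (ClassGroup (NumberField.RingOfIntegers K)) :=
    isCyclic_of_orderOf_eq_card c (by rw [hord, hcard]; rfl)
  exact ⟨mulEquivOfCyclicCardEq (by rw [hcard]; simp)⟩
end

section
/- Let p be an odd prime and let t ≥ 3 be an integer. Set n = 2p^t and suppose d = n^2 + 1 is squarefree with d ≡ 5 (mod 8). If the class number of Q(√d) equals 4, then the ideal class group of Q(√d) is isomorphic to Z/4Z (i.e., it is cyclic of order 4). -/
open NumberField in
theorem cg_ineq (n x y N : ℤ) (hn : 1 ≤ n) (hy : y ≠ 0)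
    (h : x ^ 2 - (n ^ 2 + 1) * y ^ 2 = 4 * N)
    (h1 : |y| ≤ |n * y + x|) (h2 : |y| ≤ |x - n * y|) : 2 * n ≤ 4 * |N| := by
  have key : ∀ a b : ℤ, 0 ≤ a → 1 ≤ b → a ^ 2 - (n ^ 2 + 1) * b ^ 2 = 4 * N →
      b ≤ |a - n * b| → 2 * n ≤ 4 * |N| := by
    intro a b ha hb hab hle
    rcases le_abs.mp hle with h' | h'
    · have e : (n + 1) * b ≤ a := by linarith
      have e2 : ((n + 1) * b) ^ 2 ≤ a ^ 2 := pow_le_pow_left₀ (by positivity) e 2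
      have := le_abs_self N
      have e3 : b * 1 ≤ b * b := by gcongr
      have e4 : n * 1 ≤ n * (b * b) := by gcongr; linarith
      nlinarith
    · have e : a ≤ (n - 1) * b := by linarith
      have e2 : a ^ 2 ≤ ((n - 1) * b) ^ 2 := pow_le_pow_left₀ ha e 2
      have := neg_abs_le N
      have e3 : b * 1 ≤ b * b := by gcongr
      have e4 : n * 1 ≤ n * (b * b) := by gcongr; linarith
      nlinarith
  have hb : 1 ≤ |y| := Int.one_le_abs hy
  refine key |x| |y| (abs_nonneg _) hb (by simpa using h) ?_
  rcases abs_cases x with ⟨hx, _⟩ | ⟨hx, _⟩ <;> rcases abs_cases y with ⟨hy', _⟩ | ⟨hy', _⟩ <;>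
    rw [hx] <;> rw [hy'] at h1 h2 ⊢
  · exact h2
  · rw [show x - n * -y = n * y + x by ring]; exact h1
  · rw [show -x - n * y = -(n * y + x) by ring, abs_neg]; exact h1
  · rw [show -x - n * -y = -(x - n * y) by ring, abs_neg]; exact h2

theorem cg_li (n d : ℕ) (hn : 1 ≤ n) (hd : d = n ^ 2 + 1)
    (K : Type) [Field K] [NumberField K] (α : K) (hα : α ^ 2 = (d : K)) :
    LinearIndependent ℚ ![(1 : K), α] := by
  rw [LinearIndependent.pair_iff]
  intro s r h
  have hr : r = 0 := by
    by_contra hr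
    have hrK : (algebraMap ℚ K r) ≠ 0 := by simpa using hr
    have e : α = algebraMap ℚ K (-s / r) := by
      rw [map_div₀, eq_div_iff hrK, map_neg]
      simp only [Algebra.smul_def, mul_one] at h
      linear_combination h
    have e2 : (-s / r) ^ 2 = (d : ℚ) := by
      apply (algebraMap ℚ K).injective
      rw [map_pow, ← e, hα]; simp
    have hs : IsSquare ((d : ℕ) : ℚ) := ⟨-s / r, by rw [← e2]; ring⟩
    rw [Rat.isSquare_natCast_iff] at hs
    obtain ⟨m, hm⟩ := hs
    have h1 : n < m := by by_contra hh; push Not at hh; nlinarith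
    nlinarith
  subst hr
  simpa [Algebra.smul_def] using h

theorem cg_coords (n d : ℕ) (hn : 1 ≤ n) (hd : d = n ^ 2 + 1)
    (K : Type) [Field K] [NumberField K] (hdeg : Module.finrank ℚ K = 2)
    (α : K) (hα : α ^ 2 = (d : K)) (u v : ℚ) :
    Algebra.norm ℚ (algebraMap ℚ K u + algebraMap ℚ K v * α) = u ^ 2 - d * v ^ 2 ∧
    Algebra.trace ℚ K (algebraMap ℚ K u + algebraMap ℚ K v * α) = 2 * u := by
  have hli := cg_li n d hn hd K α hα
  let b : Module.Basis (Fin 2) ℚ K := basisOfLinearIndependentOfCardEqFinrank hli (by simp [hdeg])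
  have hb : ⇑b = ![(1 : K), α] := coe_basisOfLinearIndependentOfCardEqFinrank _ _
  have hb0 : b 0 = 1 := by simp [hb]
  have hb1 : b 1 = α := by simp [hb]
  have hM : Algebra.leftMulMatrix b (algebraMap ℚ K u + algebraMap ℚ K v * α)
      = !![u, d * v; v, u] := by
    have c0 : (algebraMap ℚ K u + algebraMap ℚ K v * α) * b 0 = u • b 0 + v • b 1 := by
      rw [hb0, hb1, Algebra.smul_def, Algebra.smul_def]; ring
    have c1 : (algebraMap ℚ K u + algebraMap ℚ K v * α) * b 1 = (d * v) • b 0 + u • b 1 := by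
      rw [hb0, hb1, Algebra.smul_def, Algebra.smul_def, map_mul, map_natCast]
      linear_combination (algebraMap ℚ K v) * hα
    ext i j
    rw [Algebra.leftMulMatrix_eq_repr_mul]
    fin_cases j
    · simp only [Fin.zero_eta, c0]
      fin_cases i <;> simp
    · simp only [Fin.mk_one, c1]
      fin_cases i <;> simp
  constructor
  · rw [Algebra.norm_eq_matrix_det b, hM, Matrix.det_fin_two_of]; ring
  · rw [Algebra.trace_eq_matrix_trace b, hM, Matrix.trace_fin_two_of]; ring

theorem cg_span (n d : ℕ) (hn : 1 ≤ n) (hd : d = n ^ 2 + 1)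
    (K : Type) [Field K] [NumberField K] (hdeg : Module.finrank ℚ K = 2)
    (α : K) (hα : α ^ 2 = (d : K)) (z : K) :
    ∃ u v : ℚ, z = algebraMap ℚ K u + algebraMap ℚ K v * α := by
  have hli := cg_li n d hn hd K α hα
  let b : Module.Basis (Fin 2) ℚ K := basisOfLinearIndependentOfCardEqFinrank hli (by simp [hdeg])
  have hb : ⇑b = ![(1 : K), α] := coe_basisOfLinearIndependentOfCardEqFinrank _ _
  refine ⟨b.repr z 0, b.repr z 1, ?_⟩
  have := b.sum_repr z
  rw [Fin.sum_univ_two, hb] at this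
  simp only [Matrix.cons_val_zero, Matrix.cons_val_one, Algebra.smul_def, mul_one] at this
  exact this.symm

open NumberField in
/-- integer coordinates -/
theorem cg_int (n d : ℕ) (hn : 1 ≤ n) (hd : d = n ^ 2 + 1) (hsf : Squarefree d)
    (K : Type) [Field K] [NumberField K] (hdeg : Module.finrank ℚ K = 2)
    (α : K) (hα : α ^ 2 = (d : K)) (a : 𝓞 K) (ha : algebraMap (𝓞 K) K a = α) (g : 𝓞 K) :
    ∃ x y : ℤ, 2 * g = x + y * a := by
  obtain ⟨u, v, huv⟩ := cg_span n d hn hd K hdeg α hα (g : K)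
  have huv2 : algebraMap (𝓞 K) K g = algebraMap ℚ K u + algebraMap ℚ K v * α := huv
  have hd0 : (d : ℚ) ≠ 0 := by rw [hd]; positivity
  have hN : ((Algebra.norm ℤ g : ℤ) : ℚ) = u ^ 2 - d * v ^ 2 := by
    rw [Algebra.coe_norm_int, huv]; exact (cg_coords n d hn hd K hdeg α hα u v).1
  have hT : ((Algebra.trace ℤ (𝓞 K) g : ℤ) : ℚ) = 2 * u := by
    rw [Algebra.coe_trace_int, huv]; exact (cg_coords n d hn hd K hdeg α hα u v).2
  have hT2 : ((Algebra.trace ℤ (𝓞 K) (g * a) : ℤ) : ℚ) = 2 * (d * v) := by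
    rw [Algebra.coe_trace_int]
    have : algebraMap (𝓞 K) K (g * a) = algebraMap ℚ K (d * v) + algebraMap ℚ K u * α := by
      rw [map_mul (algebraMap ℚ K), map_natCast, map_mul, ha, huv2]
      linear_combination (algebraMap ℚ K v) * hα
    change Algebra.trace ℚ K (algebraMap (𝓞 K) K (g * a)) = _
    rw [this]; exact (cg_coords n d hn hd K hdeg α hα _ _).2
  set x := Algebra.trace ℤ (𝓞 K) g
  set Y := Algebra.trace ℤ (𝓞 K) (g * a)
  set N := Algebra.norm ℤ g
  have hdvd : (d : ℤ) ∣ Y ^ 2 := by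
    refine ⟨x ^ 2 - 4 * N, ?_⟩
    have : (Y : ℚ) ^ 2 = d * (x ^ 2 - 4 * N) := by rw [hT2, hT, hN]; ring
    exact_mod_cast this
  have hsfZ : Squarefree (d : ℤ) := by rwa [Int.squarefree_natCast]
  rw [hsfZ.dvd_pow_iff_dvd (by norm_num)] at hdvd
  obtain ⟨y, hy⟩ := hdvd
  refine ⟨x, y, ?_⟩
  have hv : (y : ℚ) = 2 * v := by
    rw [hy] at hT2; push_cast at hT2
    apply mul_left_cancel₀ hd0; linarith
  apply FaithfulSMul.algebraMap_injective (𝓞 K) K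
  simp only [map_mul, map_add, map_intCast, map_ofNat]
  rw [ha, huv2]
  have e1 : (x : K) = algebraMap ℚ K (2 * u) := by rw [← hT]; simp
  have e2 : (y : K) = algebraMap ℚ K (2 * v) := by rw [← hv]; simp
  rw [e1, e2]; simp; ring

open NumberField in
theorem cg_norm (n d : ℕ) (hn : 1 ≤ n) (hd : d = n ^ 2 + 1)
    (K : Type) [Field K] [NumberField K] (hdeg : Module.finrank ℚ K = 2)
    (α : K) (hα : α ^ 2 = (d : K)) (a : 𝓞 K) (ha : algebraMap (𝓞 K) K a = α) (g : 𝓞 K)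
    (x y : ℤ) (h : 2 * g = x + y * a) :
    x ^ 2 - d * y ^ 2 = 4 * Algebra.norm ℤ g ∧ Algebra.trace ℤ (𝓞 K) g = x := by
  have hg : (g : K) = algebraMap ℚ K (x / 2) + algebraMap ℚ K (y / 2) * α := by
    have := congrArg (algebraMap (𝓞 K) K) h
    simp only [map_mul, map_add, map_intCast, map_ofNat] at this
    rw [ha] at this
    simp only [map_div₀, map_intCast, map_ofNat]
    linear_combination this / 2
  have hc := cg_coords n d hn hd K hdeg α hα (x / 2) (y / 2)
  rw [← hg, ← Algebra.coe_norm_int, ← Algebra.coe_trace_int] at hc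
  constructor
  · have : (x : ℚ) ^ 2 - d * y ^ 2 = 4 * (Algebra.norm ℤ g : ℤ) := by rw [hc.1]; ring
    exact_mod_cast this
  · have : ((Algebra.trace ℤ (𝓞 K) g : ℤ) : ℚ) = x := by rw [hc.2]; ring
    exact_mod_cast this

open NumberField in
theorem cg_core (p t : ℕ) (hp : 2 ≤ p) (ht : 3 ≤ t) (n d : ℕ) (hn : n = 2 * p ^ t)
    (hd : d = n ^ 2 + 1) (hsf : Squarefree d)
    (K : Type) [Field K] [NumberField K] (hdeg : Module.finrank ℚ K = 2)
    (α : K) (hα : α ^ 2 = (d : K)) (a : 𝓞 K) (ha : algebraMap (𝓞 K) K a = α)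
    (b : 𝓞 K) (hb : 2 * b = 1 + a) (g : 𝓞 K) (hg1 : g ∣ (p : 𝓞 K) ^ 2) (hg2 : g ∣ b)
    (hg3 : ¬ IsUnit g) : False := by
  have hn1 : 1 ≤ n := by rw [hn]; have : 0 < p ^ t := by positivity
                         omega
  have haa : a ^ 2 = (d : 𝓞 K) := by
    apply FaithfulSMul.algebraMap_injective (𝓞 K) K
    rw [map_pow, ha, hα, map_natCast]
  have hex : ∃ m : ℕ, ∃ g : 𝓞 K, ∃ x y : ℤ, g ∣ (p : 𝓞 K) ^ 2 ∧ g ∣ b ∧ ¬ IsUnit g ∧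
      2 * g = x + y * a ∧ m = y.natAbs := by
    obtain ⟨x, y, h⟩ := cg_int n d hn1 hd hsf K hdeg α hα a ha g
    exact ⟨_, g, x, y, hg1, hg2, hg3, h, rfl⟩
  classical
  obtain ⟨g, x, y, hg1, hg2, hg3, h, hm⟩ := Nat.find_spec hex
  have hmin : ∀ (x' y' : ℤ) (e : 𝓞 K), IsUnit e → 2 * (g * e) = x' + y' * a → |y| ≤ |y'| := by
    intro x' y' e he h'
    have := Nat.find_min' hex (m := y'.natAbs) ⟨g * e, x', y', (he.mul_right_dvd).2 hg1,
      (he.mul_right_dvd).2 hg2, fun hu => hg3 (isUnit_of_mul_isUnit_left hu), h', rfl⟩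
    rw [hm] at this
    rw [Int.abs_eq_natAbs, Int.abs_eq_natAbs]
    exact_mod_cast this
  have hee : ((n : 𝓞 K) + a) * (a - n) = 1 := by
    have : (d : 𝓞 K) = (n : 𝓞 K) ^ 2 + 1 := by rw [hd]; push_cast; rfl
    linear_combination haa + this
  have h1 : |y| ≤ |(n : ℤ) * y + x| := by
    refine hmin (n * x + d * y) _ (n + a) (IsUnit.of_mul_eq_one _ hee) ?_
    push_cast
    linear_combination ((n : 𝓞 K) + a) * h + (y : 𝓞 K) * haa
  have h2 : |y| ≤ |x - (n : ℤ) * y| := by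
    refine hmin (d * y - n * x) _ (a - n) (IsUnit.of_mul_eq_one _ ((mul_comm _ _).trans hee)) ?_
    push_cast
    linear_combination (a - (n : 𝓞 K)) * h + (y : 𝓞 K) * haa
  obtain ⟨hN, hT⟩ := cg_norm n d hn1 hd K hdeg α hα a ha g x y h
  have hb1 := cg_norm n d hn1 hd K hdeg α hα a ha b 1 1 (by push_cast; linear_combination hb)
  by_cases hy : y = 0
  · -- rational generator
    subst hy
    obtain ⟨w, hw⟩ := hg2
    obtain ⟨r, s, hrs⟩ := cg_int n d hn1 hd hsf K hdeg α hα a ha w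
    have hx : 2 * g = (x : 𝓞 K) := by rw [h]; simp
    have h4 : 2 * (2 * b) = ((x * r : ℤ) : 𝓞 K) + ((x * s : ℤ) : 𝓞 K) * a := by
      push_cast; rw [hw]; linear_combination (2 * w) * hx + (x : 𝓞 K) * hrs
    have h5 := (cg_norm n d hn1 hd K hdeg α hα a ha _ _ _ h4).2
    rw [show (2 : 𝓞 K) * b = b + b by ring, map_add, hb1.2] at h5
    -- x r = 2, 4 N g = x ^ 2
    have hxd : x ∣ 2 := ⟨r, by linarith⟩
    have hx4 : x ^ 2 ∣ 4 := by have := pow_dvd_pow_of_dvd hxd 2; norm_num at this; exact this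
    have h6 : x ^ 2 = 4 * Algebra.norm ℤ g := by simpa using hN
    have h7 : Algebra.norm ℤ g ∣ 1 := by
      rw [h6] at hx4
      exact (mul_dvd_mul_iff_left (a := (4 : ℤ)) (by norm_num)).1 (by simpa using hx4)
    apply hg3
    rw [NumberField.isUnit_iff_norm, RingOfIntegers.coe_norm, ← Algebra.coe_norm_int]
    have h8 := Int.isUnit_iff_abs_eq.1 (isUnit_of_dvd_one h7)
    exact_mod_cast h8
  · have hI := cg_ineq n x y _ (by exact_mod_cast hn1) hy (by rw [← hN, hd]; push_cast; ring) h1 h2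
    have hq := cg_norm n d hn1 hd K hdeg α hα a ha ((p : 𝓞 K) ^ 2) (2 * p ^ 2) 0
      (by push_cast; ring)
    have hr := cg_norm n d hn1 hd K hdeg α hα a ha (b + (p : 𝓞 K) ^ 2) (2 * p ^ 2 + 1) 1
      (by push_cast; linear_combination hb)
    have d1 := map_dvd (Algebra.norm ℤ) hg1
    have d2 := map_dvd (Algebra.norm ℤ) (dvd_add hg2 hg1)
    have e1 : Algebra.norm ℤ ((p : 𝓞 K) ^ 2) = (p : ℤ) ^ 4 := by linarith [hq.1]
    obtain ⟨s, rfl⟩ : ∃ s, t = s + 2 := ⟨t - 2, by omega⟩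
    have e2 : Algebra.norm ℤ (b + (p : 𝓞 K) ^ 2) = (p : ℤ) ^ 4 * (1 - p ^ (2 * s)) + p ^ 2 := by
      have := hr.1
      rw [hd, hn] at this; push_cast at this
      have e3 : ((p : ℤ) ^ (s + 2)) ^ 2 = p ^ 4 * p ^ (2 * s) := by ring
      have h4 : (4 : ℤ) * Algebra.norm ℤ (b + (p : 𝓞 K) ^ 2)
          = 4 * ((p : ℤ) ^ 4 * (1 - p ^ (2 * s)) + p ^ 2) := by
        linear_combination -this - 4 * e3
      exact mul_left_cancel₀ (by norm_num) h4
    rw [e1] at d1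
    rw [e2] at d2
    have d3 : Algebra.norm ℤ g ∣ (p : ℤ) ^ 2 := (dvd_add_right (d1.mul_right _)).1 d2
    have l1 : |Algebra.norm ℤ g| ≤ (p : ℤ) ^ 2 :=
      Int.le_of_dvd (by positivity) ((abs_dvd _ _).2 d3)
    have l2 : (p : ℤ) ^ 2 < p ^ (s + 2) :=
      pow_lt_pow_right₀ (by exact_mod_cast hp) (by omega)
    rw [hn] at hI; push_cast at hI
    linarith


/-- If `n = 2 * p^t` with `p` an odd prime and `t ≥ 3`, `d = n^2 + 1` is
squarefree with `d ≡ 5 (mod 8)`, and the class number of `ℚ(√d)` is `4`, then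
the class group of `ℚ(√d)` is cyclic of order `4`. -/
theorem class_group_cyclic_of_two_mul_prime_pow
    (p : ℕ) (hp : p.Prime) (hodd : p ≠ 2) (t : ℕ) (ht : 3 ≤ t)
    (n : ℕ) (hn : n = 2 * p ^ t) (d : ℕ) (hd : d = n ^ 2 + 1)
    (hsf : Squarefree d) (hmod : d % 8 = 5)
    (K : Type) [Field K] [NumberField K]
    (hdeg : Module.finrank ℚ K = 2) (α : K) (hα : α ^ 2 = (d : K))
    (hcl : NumberField.classNumber K = 4) :
    Nonempty (ClassGroup (NumberField.RingOfIntegers K) ≃* Multiplicative (ZMod 4)) := by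
  have hn1 : 1 ≤ n := by
    rw [hn]
    have : 0 < p ^ t := pow_pos hp.pos t
    omega
  have hp2 : 2 ≤ p := hp.two_le
  let a : NumberField.RingOfIntegers K := ⟨α, by
    have h2 : IsIntegral ℤ (α ^ 2) := by rw [hα]; simpa using isIntegral_algebraMap (R := ℤ) (A := K) (x := (d : ℤ))
    exact IsIntegral.of_pow (n := 2) (by norm_num) h2⟩
  have ha : algebraMap (NumberField.RingOfIntegers K) K a = α := rfl
  have hdK : (d : K) = 4 * (p : K) ^ (2 * t) + 1 := by
    rw [hd, hn]; push_cast; ring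
  have hβ : ((1 + α) / 2) ^ 2 = (1 + α) / 2 + (p : K) ^ (2 * t) := by
    linear_combination hα / 4 + hdK / 4
  let b : NumberField.RingOfIntegers K := ⟨(1 + α) / 2, by
    refine ⟨Polynomial.X ^ 2 - (Polynomial.X + Polynomial.C ((p : ℤ) ^ (2 * t))), ?_, ?_⟩
    · refine Polynomial.monic_X_pow_sub ?_
      refine (Polynomial.degree_X_add_C _).le.trans_lt ?_
      norm_num
    · simp only [Polynomial.eval₂_sub, Polynomial.eval₂_add, Polynomial.eval₂_X_pow,
        Polynomial.eval₂_X, Polynomial.eval₂_C, hβ]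
      simp⟩
  have hbK : algebraMap (NumberField.RingOfIntegers K) K b = (1 + α) / 2 := rfl
  have hb : 2 * b = 1 + a := by
    apply FaithfulSMul.algebraMap_injective (NumberField.RingOfIntegers K) K
    simp only [map_mul, map_add, map_pow, map_natCast, map_ofNat, map_one]
    rw [hbK, ha]; ring
  have hbb : b ^ 2 = b + (p : NumberField.RingOfIntegers K) ^ (2 * t) := by
    apply FaithfulSMul.algebraMap_injective (NumberField.RingOfIntegers K) K
    simp only [map_mul, map_add, map_pow, map_natCast, map_ofNat, map_one]
    rw [hbK]; exact hβ
  let P : Ideal (NumberField.RingOfIntegers K) := Ideal.span {(p : NumberField.RingOfIntegers K), b}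
  have hpP : (p : NumberField.RingOfIntegers K) ∈ P := Ideal.subset_span (by simp)
  have hbP : b ∈ P := Ideal.subset_span (by simp)
  have hp0 : (p : NumberField.RingOfIntegers K) ≠ 0 := by exact_mod_cast hp.ne_zero
  have hP0 : P ≠ ⊥ := fun h => hp0 (by rw [h] at hpP; simpa using hpP)
  have hPtop : P ≠ ⊤ := by
    intro h
    have h1 : (1 : NumberField.RingOfIntegers K) ∈ P := by rw [h]; trivial
    obtain ⟨u, v, huv⟩ := Ideal.mem_span_pair.1 h1
    have hpow : (p : NumberField.RingOfIntegers K) ^ (2 * t) = p * p ^ (2 * t - 1) := by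
      rw [← pow_succ']; congr 1; omega
    have h2 : 1 - b = p * (u * (1 - b) - p ^ (2 * t - 1) * v) := by
      linear_combination (-(1 - b)) * huv - v * hbb - v * hpow
    have tb := (cg_norm n d hn1 hd K hdeg α hα a ha (1 - b) 1 (-1)
      (by push_cast; linear_combination -hb)).2
    obtain ⟨r, s, hrs⟩ := cg_int n d hn1 hd hsf K hdeg α hα a ha
      (u * (1 - b) - p ^ (2 * t - 1) * v)
    have tc := (cg_norm n d hn1 hd K hdeg α hα a ha (1 - b) (p * r) (p * s)
      (by push_cast; linear_combination 2 * h2 + (p : NumberField.RingOfIntegers K) * hrs)).2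
    rw [tb] at tc
    have : (p : ℤ) ∣ 1 := ⟨r, tc⟩
    have := Int.le_of_dvd one_pos this
    omega
  let c : ClassGroup (NumberField.RingOfIntegers K) :=
    ClassGroup.mk0 ⟨P, mem_nonZeroDivisors_iff_ne_zero.2 hP0⟩
  have hc : c ^ 2 ≠ 1 := by
    intro hc
    rw [← map_pow, ClassGroup.mk0_eq_one_iff] at hc
    obtain ⟨g, hg⟩ := hc.principal
    have hg' : P ^ 2 = Ideal.span {g} := hg
    have hpp : (p : NumberField.RingOfIntegers K) ^ 2 ∈ P ^ 2 := Ideal.pow_mem_pow hpP 2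
    have hb2 : b ∈ P ^ 2 := by
      have h1 : b ^ 2 ∈ P ^ 2 := Ideal.pow_mem_pow hbP 2
      have h2 : b = b ^ 2 - p ^ (2 * t - 2) * (p : NumberField.RingOfIntegers K) ^ 2 := by
        rw [← pow_add, show 2 * t - 2 + 2 = 2 * t by omega]
        linear_combination -hbb
      rw [h2]
      exact Ideal.sub_mem _ h1 (Ideal.mul_mem_left _ _ hpp)
    rw [hg', Ideal.mem_span_singleton] at hpp hb2
    refine cg_core p t hp2 ht n d hn hd hsf K hdeg α hα a ha b hb g hpp hb2 ?_
    intro hu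
    rw [Ideal.span_singleton_eq_top.2 hu] at hg'
    exact hPtop (top_le_iff.1 (hg'.ge.trans (Ideal.pow_le_self (by norm_num))))
  have hcard : Nat.card (ClassGroup (NumberField.RingOfIntegers K)) = 4 := by
    rw [Nat.card_eq_fintype_card]; exact hcl
  have hord : orderOf c = 4 := by
    have h1 : orderOf c ∣ 2 ^ (1 + 1) := by
      rw [← hcard.trans (by norm_num : 4 = 2 ^ (1 + 1))]; exact orderOf_dvd_natCard c
    have := orderOf_eq_prime_pow (p := 2) (n := 1) (x := c) (by simpa using hc)
      (orderOf_dvd_iff_pow_eq_one.1 h1)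
    simpa using this
  have hcyc : IsCyclic (ClassGroup (NumberField.RingOfIntegers K)) :=
    isCyclic_of_orderOf_eq_card c (hord.trans hcard.symm)
  have e := zmodCyclicMulEquiv hcyc
  rw [hcard] at e
  exact ⟨e.symm⟩
end

section
/- Let n be a positive integer having more than two distinct odd prime factors, and suppose d = n^2 + 4 is squarefree. If the class number of Q(√d) equals 4, then the ideal class group of Q(√d) is isomorphic to Z/2Z × Z/2Z (the Klein four-group). -/
theorem aux_descent_s18 (n m : ℕ) (hm : m < n) : ∀ (y x : ℕ) (e : ℤ), e.natAbs = m →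
    (x:ℤ)^2 = ((n:ℤ)^2+4) * (y:ℤ)^2 + 4 * e → IsSquare m := by
  intro y
  induction y using Nat.strong_induction_on with
  | _ y ih =>
  intro x e he h
  have hev : ∃ k : ℤ, (x:ℤ) = n * y + 2 * k := by
    have h2 : Even ((x:ℤ) - n * y) := by
      have : Even (((x:ℤ) - n * y)*((x:ℤ) + n * y)) := ⟨2*(y^2+e), by linear_combination h⟩
      rcases Int.even_mul.1 this with h | h
      · exact h
      · have := h.sub (even_two_mul ((n:ℤ)*y))
        have e : (x:ℤ) + n * y - 2 * (n * y) = x - n * y := by ring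
        rwa [e] at this
    obtain ⟨k, hk⟩ := h2
    exact ⟨k, by linear_combination hk⟩
  obtain ⟨k, hk⟩ := hev
  have hE : e = n * y * k + k^2 - y^2 := by
    rw [hk] at h; linarith
  have habs : |e| < n := by
    rw [Int.abs_eq_natAbs, he]; exact_mod_cast hm
  obtain ⟨hl, hu⟩ := abs_lt.1 habs
  rcases Nat.eq_zero_or_pos y with hy | hy
  · subst hy
    refine ⟨k.natAbs, ?_⟩
    rw [← he, hE, ← Int.natAbs_mul]; simp [sq]
  · have hy' : (1:ℤ) ≤ y := by exact_mod_cast hy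
    have hn : (1:ℤ) ≤ n := by omega
    have hx : (0:ℤ) ≤ x := by positivity
    have k1 : k < y := by
      by_contra! hc
      have : (n:ℤ) * 1 ≤ n * (y * k) := by
        apply mul_le_mul_of_nonneg_left _ (by omega); nlinarith
      nlinarith
    have k2 : -(y:ℤ) < k := by
      by_contra! hc
      have h1 : 0 ≤ (-k - y) * (n*y + k - y) := mul_nonneg (by omega) (by linarith)
      have : (n:ℤ) * 1 ≤ n * (y * y) := by
        apply mul_le_mul_of_nonneg_left _ (by omega); nlinarith
      nlinarith
    refine ih k.natAbs (by omega) (n*k-2*y : ℤ).natAbs (-e) (by simpa using he) ?_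
    rw [Int.natAbs_sq, Int.natAbs_sq, hE]; ring

theorem aux_rat (d : ℕ) (hd : Squarefree d) (y : ℚ) (z : ℤ) (h : (d:ℚ) * y^2 = z) : ∃ w : ℤ, y = w := by
  have hq : (y.den:ℚ) ≠ 0 := by exact_mod_cast y.den_nz
  have h1 : (d:ℤ) * y.num^2 = z * y.den^2 := by
    have : (d:ℚ) * y.num^2 = z * y.den^2 := by
      rw [← h]; nth_rw 2 [← Rat.num_div_den y]; field_simp
    exact_mod_cast this
  have h2 : ((y.den:ℤ)^2) ∣ (d:ℤ) * y.num^2 := ⟨z, by rw [h1]; ring⟩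
  have hc : IsCoprime ((y.den:ℤ)^2) (y.num^2) := by
    apply IsCoprime.pow
    rw [Int.isCoprime_iff_gcd_eq_one]
    simpa [Int.gcd, Nat.gcd_comm, Nat.Coprime] using y.reduced
  have h3 : y.den * y.den ∣ d := by
    have := hc.dvd_of_dvd_mul_right h2
    rw [← sq]; exact_mod_cast this
  have := hd _ h3
  rw [Nat.isUnit_iff] at this
  exact ⟨y.num, ((Rat.den_eq_one_iff y).1 this).symm⟩

open NumberField in
theorem aux_norm_s18 (d : ℕ) (hsf : Squarefree d) (hns : ¬ IsSquare (d:ℚ))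
    (K : Type) [Field K] [NumberField K]
    (hdeg : Module.finrank ℚ K = 2) (α : K) (hα : α ^ 2 = (d : K)) (β : 𝓞 K) :
    ∃ x y : ℤ, x^2 = d * y^2 + 4 * Algebra.norm ℤ β ∧ 2 * (β:K) = x + y * α := by
  have hli : LinearIndependent ℚ ![(1:K), α] := by
    rw [LinearIndependent.pair_iff]
    intro s t h
    have ht : t = 0 := by
      by_contra ht
      apply hns
      have h3 : (t:K) ≠ 0 := by exact_mod_cast ht
      have h1 : α = ((-s/t : ℚ) : K) := by
        simp only [Algebra.smul_def, eq_ratCast] at h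
        push_cast; field_simp; linear_combination h
      refine ⟨-s/t, ?_⟩
      have : ((d:ℚ):K) = ((-s/t*(-s/t):ℚ):K) := by
        rw [Rat.cast_mul, ← h1, ← sq, hα]; simp
      exact_mod_cast this
    subst ht
    simpa using h
  let b := basisOfLinearIndependentOfCardEqFinrank hli (by simp [hdeg])
  have hb : ⇑b = ![1, α] := by simp [b]
  have hb0 : b 0 = 1 := by simp [hb]
  have hb1 : b 1 = α := by simp [hb]
  obtain ⟨p, q, hpq⟩ : ∃ p q : ℚ, (β:K) = p • b 0 + q • b 1 :=
    ⟨b.repr β 0, b.repr β 1, by rw [← Fin.sum_univ_two (fun i => b.repr (β:K) i • b i), b.sum_repr]⟩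
  have e0 : (β:K) * b 0 = p • b 0 + q • b 1 := by rw [hb0, mul_one, ← hb0]; exact hpq
  have e1 : (β:K) * b 1 = (d*q) • b 0 + p • b 1 := by
    rw [hpq, hb0, hb1]; simp only [Algebra.smul_def, eq_ratCast]
    push_cast; linear_combination (q:K) * hα
  have hM : Algebra.leftMulMatrix b (β:K) = !![p, d*q; q, p] := by
    ext i j
    rw [Algebra.leftMulMatrix_eq_repr_mul]
    fin_cases j <;> fin_cases i <;> simp [e0, e1]
  have hnm : Algebra.norm ℚ (β:K) = p^2 - d*q^2 := by
    rw [Algebra.norm_eq_matrix_det b, hM, Matrix.det_fin_two_of]; ring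
  have htr : Algebra.trace ℚ K (β:K) = 2*p := by
    rw [Algebra.trace_eq_matrix_trace b, hM, Matrix.trace_fin_two_of]; ring
  have hnm' := Algebra.coe_norm_int β
  have htr' := Algebra.coe_trace_int β
  rw [hnm] at hnm'
  rw [htr] at htr'
  obtain ⟨w, hw⟩ := aux_rat d hsf (2*q) ((Algebra.trace ℤ _ β)^2 - 4 * Algebra.norm ℤ β) (by
    push_cast; rw [hnm', htr']; ring)
  refine ⟨Algebra.trace ℤ _ β, w, ?_, ?_⟩
  swap
  · have e1 : ((Algebra.trace ℤ _ β : ℤ) : K) = ((2 * p : ℚ) : K) := by rw [← htr']; simp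
    have e2 : (w : K) = ((2 * q : ℚ) : K) := by rw [hw]; simp
    rw [e1, e2, hpq, hb0, hb1]; simp only [Algebra.smul_def, eq_ratCast]
    push_cast; ring
  have : ((Algebra.trace ℤ _ β : ℤ):ℚ)^2 = d * (w:ℚ)^2 + 4 * (Algebra.norm ℤ β : ℤ) := by
    rw [hnm', htr', ← hw]; ring
  exact_mod_cast this

theorem aux_group (G : Type) [CommGroup G] (h4 : Nat.card G = 4) (a b c : G)
    (ha : a ≠ 1) (hb : b ≠ 1) (hc : c ≠ 1) (hab : a ≠ b) (hac : a ≠ c) (hbc : b ≠ c)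
    (hab' : a * b ≠ 1) (hac' : a * c ≠ 1) (hbc' : b * c ≠ 1) :
    Nonempty (G ≃* (Multiplicative (ZMod 2) × Multiplicative (ZMod 2))) := by
  classical
  have : Finite G := Nat.finite_of_card_ne_zero (by omega)
  have := Fintype.ofFinite G
  have hS : ({1, a, b, c} : Finset G) = Finset.univ := by
    apply Finset.eq_univ_of_card
    rw [← Nat.card_eq_fintype_card, h4]
    grind
  have hall : ∀ g : G, g = 1 ∨ g = a ∨ g = b ∨ g = c := by
    intro g; have := Finset.mem_univ g; rw [← hS] at this; simpa using this
  have hsq : ∀ g : G, g ^ 2 = 1 := by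
    have key : ∀ g : G, g * g⁻¹ = 1 := fun g => mul_inv_cancel g
    intro g
    rw [sq]
    have h1 := hall g⁻¹
    have h2 := hall g
    have h3 := key g
    rcases h1 with h1 | h1 | h1 | h1 <;> rw [h1] at h3 <;> rcases h2 with h2 | h2 | h2 | h2 <;>
      subst h2 <;> simp_all [mul_comm]
  have hK : IsKleinFour G := by
    refine ⟨h4, ?_⟩
    rcases (Nat.dvd_prime Nat.prime_two).1 (Monoid.exponent_dvd_of_forall_pow_eq_one hsq) with h | h
    · exact absurd (by simpa [h] using Monoid.pow_exponent_eq_one a) ha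
    · exact h
  have hK' : IsKleinFour (Multiplicative (ZMod 2) × Multiplicative (ZMod 2)) := by
    refine ⟨by simp, ?_⟩
    have h2 : ∀ g : Multiplicative (ZMod 2) × Multiplicative (ZMod 2), g ^ 2 = 1 := by decide
    rcases (Nat.dvd_prime Nat.prime_two).1 (Monoid.exponent_dvd_of_forall_pow_eq_one h2) with h | h
    · exact absurd (Monoid.exp_eq_one_iff.1 h) (not_subsingleton _)
    · exact h
  exact IsKleinFour.nonempty_mulEquiv

open NumberField nonZeroDivisors

theorem aux_nonprincipal (n : ℕ) (hsf : Squarefree (n^2+4)) (hns : ¬ IsSquare (((n^2+4:ℕ)):ℚ))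
    (K : Type) [Field K] [NumberField K]
    (hdeg : Module.finrank ℚ K = 2) (α : K) (hα : α ^ 2 = ((n^2+4 : ℕ) : K))
    (I : Ideal (𝓞 K)) (hI : I.absNorm < n) (hI' : ¬ IsSquare I.absNorm) : ¬ I.IsPrincipal := by
  rintro ⟨β, hβ⟩
  rw [Ideal.submodule_span_eq] at hβ
  subst hβ
  rw [Ideal.absNorm_span_singleton] at hI hI'
  obtain ⟨x, y, h, -⟩ := aux_norm_s18 _ hsf hns K hdeg α hα β
  apply hI'
  refine aux_descent_s18 n _ hI y.natAbs x.natAbs _ rfl ?_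
  rw [Int.natAbs_sq, Int.natAbs_sq, h]; push_cast; ring

theorem aux_prime (n : ℕ) (hsf : Squarefree (n^2+4)) (hns : ¬ IsSquare (((n^2+4:ℕ)):ℚ))
    (K : Type) [Field K] [NumberField K]
    (hdeg : Module.finrank ℚ K = 2) (α : K) (hα : α ^ 2 = ((n^2+4 : ℕ) : K))
    (p : ℕ) (hp : p.Prime) (hp2 : p ≠ 2) (hpn : p ∣ n) :
    ∃ I J : Ideal (𝓞 K), I * J = Ideal.span {(p : 𝓞 K)} ∧ I.absNorm = p ∧ J.absNorm = p := by
  obtain ⟨e, he, heα⟩ : ∃ e : 𝓞 K, e^2 = n * e + 1 ∧ 2 * (e:K) = n + α := by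
    have h0 : ((n + α)/2)^2 = n * ((n + α)/2) + 1 := by
      push_cast at hα
      linear_combination hα / 4
    have hint : IsIntegral ℤ ((n + α)/2) := by
      refine ⟨Polynomial.X^2 - (Polynomial.C (n:ℤ) * Polynomial.X + Polynomial.C 1), ?_, ?_⟩
      · apply Polynomial.monic_X_pow_sub (n := 2)
        exact Polynomial.degree_linear_lt
      · simp [Polynomial.eval₂_add, Polynomial.eval₂_sub, Polynomial.eval₂_mul]
        linear_combination h0
    obtain ⟨e, he⟩ : ∃ e : 𝓞 K, (e:K) = (n + α)/2 := ⟨⟨_, hint⟩, rfl⟩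
    refine ⟨e, ?_, ?_⟩
    · apply RingOfIntegers.ext
      simpa [he] using h0
    · rw [he]; ring
  obtain ⟨m, hm⟩ := hpn
  have hmR : (n : 𝓞 K) = p * m := by rw [hm]; push_cast; rfl
  have hndvd : ∀ (s : ℤ) (β : 𝓞 K), e + s ≠ p * β := by
    intro s β h
    obtain ⟨x, y, -, h2⟩ := aux_norm_s18 _ hsf hns K hdeg α hα β
    have hK : (e:K) + s = p * β := by simpa using congrArg (fun t : 𝓞 K => (t:K)) h
    have h3 : ((p:K) * y - 1) * α = n + 2 * s - p * x := by
      linear_combination heα - 2 * hK - (p:K) * h2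
    have h4 : (p:ℚ) * y - 1 ≠ 0 := by
      intro h
      have h5 : (p:ℤ) * y = 1 := by
        have : (p:ℚ) * y = 1 := by linarith
        exact_mod_cast this
      have : (p:ℤ) ∣ 1 := ⟨y, h5.symm⟩
      exact hp.one_lt.ne' (by simpa using Int.natAbs_dvd_natAbs.2 this)
    have h5 : ((p:ℚ) * y - 1)^2 * ((n^2+4:ℕ):ℚ) = (n + 2 * s - p * x)^2 := by
      have : ((p:K) * y - 1)^2 * ((n^2+4:ℕ):K) = (n + 2 * s - p * x)^2 := by
        rw [← h3, ← hα]; ring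
      exact_mod_cast this
    apply hns
    refine ⟨(n + 2 * s - p * x)/((p:ℚ) * y - 1), ?_⟩
    field_simp
    linear_combination h5
  have hodd : ∃ k : ℕ, p = 2 * k + 1 := hp.odd_of_ne_two hp2
  obtain ⟨k, hk⟩ := hodd
  have hkR : (p : 𝓞 K) = 2 * k + 1 := by rw [hk]; push_cast; rfl
  have hmul : Ideal.span {(p : 𝓞 K), e - 1} * Ideal.span {(p : 𝓞 K), e + 1}
      = Ideal.span {(p : 𝓞 K)} := by
    apply le_antisymm
    · rw [Ideal.span_mul_span', Ideal.span_le]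
      rintro _ ⟨a, ha, b, hb, rfl⟩
      simp only [Set.mem_insert_iff, Set.mem_singleton_iff] at ha hb
      simp only [SetLike.mem_coe, Ideal.mem_span_singleton]
      rcases ha with rfl | rfl <;> rcases hb with rfl | rfl
      · exact ⟨p, rfl⟩
      · exact ⟨e+1, rfl⟩
      · exact ⟨e-1, by ring⟩
      · exact ⟨m*e, by linear_combination he + e * hmR⟩
    · rw [Ideal.span_singleton_le_iff_mem]
      have m1 : ∀ z : 𝓞 K, (p:𝓞 K) ∈ Ideal.span {(p : 𝓞 K), z} := fun z => 
        Ideal.subset_span (by simp)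
      have m2 : ∀ z : 𝓞 K, z ∈ Ideal.span {(p : 𝓞 K), z} := fun z => 
        Ideal.subset_span (by simp)
      have a1 := Ideal.mul_mem_mul (m1 (e-1)) (m1 (e+1))
      have a2 := Ideal.mul_mem_mul (m1 (e-1)) (m2 (e+1))
      have a3 := Ideal.mul_mem_mul (m2 (e-1)) (m1 (e+1))
      have := sub_mem a1 (Ideal.mul_mem_left _ (k:𝓞 K) (sub_mem a2 a3))
      have e : (p:𝓞 K) * p - k * (p * (e+1) - (e-1) * p) = p := by
        linear_combination (p:𝓞 K) * hkR
      rwa [e] at this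
  have hne1 : Ideal.span {(p : 𝓞 K), e - 1} ≠ ⊤ := by
    rw [Ne, Ideal.eq_top_iff_one, Ideal.mem_span_pair]
    rintro ⟨a, b, h⟩
    refine hndvd 1 (a * (e+1) + b * m * e) ?_
    push_cast
    linear_combination -(e+1) * h + b * he + b * e * hmR
  have hne2 : Ideal.span {(p : 𝓞 K), e + 1} ≠ ⊤ := by
    rw [Ne, Ideal.eq_top_iff_one, Ideal.mem_span_pair]
    rintro ⟨a, b, h⟩
    refine hndvd (-1) (a * (e-1) + b * m * e) ?_
    push_cast
    linear_combination -(e-1) * h + b * he + b * e * hmR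
  have hN : (Ideal.span {(p : 𝓞 K), e - 1}).absNorm * (Ideal.span {(p : 𝓞 K), e + 1}).absNorm
      = p^2 := by
    rw [← map_mul, hmul, Ideal.absNorm_span_singleton]
    have : (p : 𝓞 K) = algebraMap ℤ (𝓞 K) p := by simp
    rw [this, Algebra.norm_algebraMap, RingOfIntegers.rank, hdeg]
    simp [Int.natAbs_pow]
  have h1 : (Ideal.span {(p : 𝓞 K), e - 1}).absNorm ≠ 1 := by rwa [Ne, Ideal.absNorm_eq_one_iff]
  have h2 : (Ideal.span {(p : 𝓞 K), e + 1}).absNorm ≠ 1 := by rwa [Ne, Ideal.absNorm_eq_one_iff]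
  exact ⟨_, _, hmul, (hp.mul_eq_prime_sq_iff h1 h2).1 hN⟩

theorem aux_main (n : ℕ) (hsf : Squarefree (n^2+4)) (hns : ¬ IsSquare (((n^2+4:ℕ)):ℚ))
    (K : Type) [Field K] [NumberField K]
    (hdeg : Module.finrank ℚ K = 2) (α : K) (hα : α ^ 2 = ((n^2+4 : ℕ) : K)) :
    ∃ c : ℕ → ClassGroup (𝓞 K), ∀ p q : ℕ, p.Prime → q.Prime → p ≠ 2 → q ≠ 2 → p ∣ n → q ∣ n →
      p ≠ q → p * q < n → c p ≠ 1 ∧ c p ≠ c q ∧ c p * c q ≠ 1 := by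
  have H := fun p : {p : ℕ // p.Prime ∧ p ≠ 2 ∧ p ∣ n} =>
    aux_prime n hsf hns K hdeg α hα p.1 p.2.1 p.2.2.1 p.2.2.2
  choose I J hIJ hI hJ using H
  have ne0 : ∀ (L : Ideal (𝓞 K)) (p : ℕ), p.Prime → L.absNorm = p → L ∈ (Ideal (𝓞 K))⁰ := by
    intro L p hp h
    rw [mem_nonZeroDivisors_iff_ne_zero]
    rintro rfl
    simp at h
    exact hp.ne_zero h.symm
  classical
  refine ⟨fun p => if h : p.Prime ∧ p ≠ 2 ∧ p ∣ n then
    ClassGroup.mk0 ⟨I ⟨p, h⟩, ne0 _ p h.1 (hI _)⟩ else 1, ?_⟩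
  intro p q hp hq hp2 hq2 hpn hqn hpq hlt
  have hP : p.Prime ∧ p ≠ 2 ∧ p ∣ n := ⟨hp, hp2, hpn⟩
  have hQ : q.Prime ∧ q ≠ 2 ∧ q ∣ n := ⟨hq, hq2, hqn⟩
  simp only [dif_pos hP, dif_pos hQ]
  have hsq : ¬ IsSquare (p * q) := by
    rintro ⟨r, hr⟩
    have : Squarefree (p * q) := 
      (Nat.squarefree_mul ((Nat.coprime_primes hp hq).2 hpq)).2 ⟨hp.squarefree, hq.squarefree⟩
    have := Nat.isUnit_iff.1 (this r ⟨1, by rw [hr, mul_one]⟩)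
    subst this
    exact hp.one_lt.ne' (Nat.eq_one_of_mul_eq_one_right (by simpa using hr))
  have key : ∀ (A B : Ideal (𝓞 K)) (hA : A ∈ (Ideal (𝓞 K))⁰) (hB : B ∈ (Ideal (𝓞 K))⁰),
      A.absNorm = p → B.absNorm = q → ClassGroup.mk0 ⟨A, hA⟩ * ClassGroup.mk0 ⟨B, hB⟩ ≠ 1 := by
    intro A B hA hB h1 h2
    rw [← map_mul]
    change ClassGroup.mk0 ⟨A * B, mul_mem hA hB⟩ ≠ 1
    rw [Ne, ClassGroup.mk0_eq_one_iff]
    have h : (A * B).absNorm = p * q := by rw [map_mul, h1, h2]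
    exact aux_nonprincipal n hsf hns K hdeg α hα _ (h ▸ hlt) (h ▸ hsq)
  have hinv : ClassGroup.mk0 ⟨I ⟨q, hQ⟩, ne0 _ q hq (hI _)⟩ *
      ClassGroup.mk0 ⟨J ⟨q, hQ⟩, ne0 _ q hq (hJ _)⟩ = 1 := by
    rw [← map_mul]
    change ClassGroup.mk0 ⟨I ⟨q, hQ⟩ * J ⟨q, hQ⟩, mul_mem (ne0 _ q hq (hI _)) (ne0 _ q hq (hJ _))⟩ = 1
    rw [ClassGroup.mk0_eq_one_iff, hIJ]
    exact ⟨_, rfl⟩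
  refine ⟨?_, ?_, ?_⟩
  · rw [Ne, ClassGroup.mk0_eq_one_iff]
    apply aux_nonprincipal n hsf hns K hdeg α hα
    · rw [hI]; exact lt_of_le_of_lt (Nat.le_mul_of_pos_right _ hq.pos) hlt
    · rw [hI]; exact hp.prime.not_isSquare
  · intro h
    rw [← h] at hinv
    exact key _ _ _ _ (hI _) (hJ _) hinv
  · exact key _ _ _ _ (hI _) (hI _)

/-- If `n` is a positive integer with more than two distinct odd prime
factors, `d = n^2 + 4` is squarefree, and the class number of `ℚ(√d)` is `4`,
then the class group of `ℚ(√d)` is the Klein four-group. -/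
theorem class_group_klein_of_many_prime_factors_nsq_add_four
    (n : ℕ) (hn : 0 < n)
    (hN : 2 < (n.primeFactors.filter fun p => p ≠ 2).card)
    (d : ℕ) (hd : d = n ^ 2 + 4) (hsf : Squarefree d)
    (K : Type) [Field K] [NumberField K]
    (hdeg : Module.finrank ℚ K = 2) (α : K) (hα : α ^ 2 = (d : K))
    (hcl : NumberField.classNumber K = 4) :
    Nonempty (ClassGroup (NumberField.RingOfIntegers K) ≃*
      (Multiplicative (ZMod 2) × Multiplicative (ZMod 2))) := by
  subst hd
  have hns : ¬ IsSquare (((n^2+4:ℕ)):ℚ) := by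
    rw [Rat.isSquare_natCast_iff]
    rintro ⟨r, hr⟩
    have := Nat.isUnit_iff.1 (hsf r ⟨1, by rw [hr, mul_one]⟩)
    subst this
    omega
  obtain ⟨a, b, c, ha, hb, hc, hab, hac, hbc⟩ := Finset.two_lt_card_iff.1 hN
  simp only [Finset.mem_filter, Nat.mem_primeFactors] at ha hb hc
  obtain ⟨⟨pa, da, -⟩, a2⟩ := ha
  obtain ⟨⟨pb, db, -⟩, b2⟩ := hb
  obtain ⟨⟨pc, dc, -⟩, c2⟩ := hc
  have hlt : ∀ p q r : ℕ, p.Prime → q.Prime → r.Prime → p ∣ n → q ∣ n → r ∣ n → p ≠ q → p ≠ r →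
      q ≠ r → p * q < n := by
    intro p q r hp hq hr dp dq dr hpq hpr hqr
    have h1 := ((Nat.coprime_primes hp hq).2 hpq).mul_dvd_of_dvd_of_dvd dp dq
    have h2 : (p * q).Coprime r :=
      Nat.Coprime.mul_left ((Nat.coprime_primes hp hr).2 hpr) ((Nat.coprime_primes hq hr).2 hqr)
    have h3 := Nat.le_of_dvd hn (h2.mul_dvd_of_dvd_of_dvd h1 dr)
    have h4 : 0 < p * q := Nat.mul_pos hp.pos hq.pos
    have := hr.two_le
    nlinarith
  obtain ⟨f, hf⟩ := aux_main n hsf hns K hdeg α hα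
  have fab := hf a b pa pb a2 b2 da db hab (hlt a b c pa pb pc da db dc hab hac hbc)
  have fbc := hf b c pb pc b2 c2 db dc hbc (hlt b c a pb pc pa db dc da hbc hab.symm hac.symm)
  have fca := hf c a pc pa c2 a2 dc da hac.symm
    (hlt c a b pc pa pb dc da db hac.symm hbc.symm hab)
  refine aux_group _ ?_ (f a) (f b) (f c) fab.1 fbc.1 fca.1 fab.2.1 fca.2.1.symm fbc.2.1
    fab.2.2 (by rw [mul_comm]; exact fca.2.2) fbc.2.2
  rw [Nat.card_eq_fintype_card]
  exact hcl
end
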